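/- For all γ > 0, there exists n₀ ∈ ℕ such that for n ≥ n₀ the following holds: if H = ([n], E) is a 3-graph with d(i,j) ≥ min{(i+j)/2, n/2} + γn for all pairs {i,j} ∈ ([n] choose 2), then H contains a tight Hamilton cycle. -/

import Mathlib

open Finset
open scoped Classical

noncomputable section

/-- `H` is a `3`-graph: every edge has exactly three vertices. -/
def Is3Graph (n : ℕ) (H : Finset (Finset (Fin n))) : Prop :=
  ∀ e ∈ H, e.card = 3

/-- `d(i,j)`: the number of edges of `H` containing both vertices `i` and `j`. -/
def pairDeg {n : ℕ} (H : Finset (Finset (Fin n))) (i j : Fin n) : ℕ :=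
  (H.filter fun e => i ∈ e ∧ j ∈ e).card

/-- `H` contains a tight Hamilton cycle: there is a cyclic ordering `v₁, …, vₙ` of the
vertices such that every three cyclically consecutive vertices form an edge. -/
def HasTightHamiltonCycle {n : ℕ} (H : Finset (Finset (Fin n))) : Prop :=
  ∃ v : ZMod n ≃ Fin n, ∀ i : ZMod n, ({v i, v (i + 1), v (i + 2)} : Finset (Fin n)) ∈ H

/-- `{a, b, c}` is an edge of `H`. -/
def Edge {n : ℕ} (H : Finset (Finset (Fin n))) (a b c : Fin n) : Prop :=
  ({a, b, c} : Finset (Fin n)) ∈ H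

/-- The vertices completing the pair `a, b` to an edge. -/
def nbr {n : ℕ} (H : Finset (Finset (Fin n))) (a b : Fin n) : Finset (Fin n) :=
  univ.filter fun c => Edge H a b c

theorem mem_nbr {n : ℕ} {H : Finset (Finset (Fin n))} {a b c : Fin n} :
    c ∈ nbr H a b ↔ Edge H a b c := by simp [nbr]

theorem Edge.rot {n : ℕ} {H : Finset (Finset (Fin n))} {a b c : Fin n} (h : Edge H a b c) :
    Edge H b c a := by
  have : ({b, c, a} : Finset (Fin n)) = {a, b, c} := by ext; simp; tauto
  rw [Edge, this]; exact h

theorem Edge.swap {n : ℕ} {H : Finset (Finset (Fin n))} {a b c : Fin n} (h : Edge H a b c) :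
    Edge H b a c := by
  have : ({b, a, c} : Finset (Fin n)) = {a, b, c} := by ext; simp; tauto
  rw [Edge, this]; exact h

theorem Edge.ne {n : ℕ} {H : Finset (Finset (Fin n))} (h3 : Is3Graph n H) {a b c : Fin n}
    (h : Edge H a b c) : a ≠ b ∧ b ≠ c ∧ a ≠ c := by
  have := h3 _ h
  refine ⟨?_, ?_, ?_⟩ <;> rintro rfl
  · have := card_le_two (a := a) (b := c); simp_all
  · have := card_le_two (a := a) (b := b); simp_all
  · have h2 : ({a, b, a} : Finset (Fin n)) = {a, b} := by ext; simp; tauto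
    have := card_le_two (a := a) (b := b); simp_all

theorem card_nbr {n : ℕ} {H : Finset (Finset (Fin n))} (h3 : Is3Graph n H) {a b : Fin n}
    (hab : a ≠ b) : (nbr H a b).card = pairDeg H a b := by
  refine card_bij (fun c _ => {a, b, c}) ?_ ?_ ?_
  · intro c hc
    simp only [mem_filter]
    exact ⟨mem_nbr.1 hc, by simp, by simp⟩
  · intro c hc d hd h
    have h1 := Edge.ne h3 (mem_nbr.1 hc)
    have : c ∈ ({a, b, d} : Finset (Fin n)) := by rw [← h]; simp
    simp only [mem_insert, mem_singleton] at this
    grind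
  · intro e he
    simp only [mem_filter] at he
    obtain ⟨he, hae, hbe⟩ := he
    have h1 : ({a, b} : Finset (Fin n)) ⊆ e := by intro x; simp; rintro (rfl | rfl) <;> assumption
    have h2 : (e \ {a, b}).card = 1 := by
      rw [card_sdiff_of_subset h1, h3 e he, card_pair hab]
    obtain ⟨c, hc⟩ := card_eq_one.1 h2
    have h4 : ({a, b, c} : Finset (Fin n)) = e := by
      rw [← union_sdiff_of_subset h1, hc]; ext; simp
    exact ⟨c, mem_nbr.2 (by rw [Edge, h4]; exact he), h4⟩

/-- The pair degree condition, in terms of the values of the vertices. -/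
structure PosaCond (γ : ℝ) (n : ℕ) (H : Finset (Finset (Fin n))) : Prop where
  three : Is3Graph n H
  deg : ∀ i j : Fin n, i ≠ j →
    min (((i : ℕ) + (j : ℕ) : ℝ) / 2) ((n : ℝ) / 2) + γ * n ≤ ((nbr H i j).card : ℝ)

/-- Every three consecutive entries of the list form an edge. -/
def Tight {n : ℕ} (H : Finset (Finset (Fin n))) : List (Fin n) → Prop
  | a :: b :: c :: l => Edge H a b c ∧ Tight H (b :: c :: l)
  | _ => True

theorem tight_glue {n : ℕ} {H : Finset (Finset (Fin n))} {p q : Fin n} {B : List (Fin n)} :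
    ∀ {A : List (Fin n)}, Tight H (A ++ [p, q]) → Tight H (p :: q :: B) →
      Tight H (A ++ p :: q :: B)
  | [], _, h2 => h2
  | [x], h1, h2 => by simp [Tight] at h1; exact ⟨h1, h2⟩
  | [x, y], h1, h2 => by
      simp only [List.cons_append, List.nil_append, Tight, and_true] at h1 ⊢
      exact ⟨h1.1, h1.2, h2⟩
  | x :: y :: z :: A, h1, h2 => by
      simp only [List.cons_append, Tight] at h1 ⊢
      exact ⟨h1.1, tight_glue (A := y :: z :: A) h1.2 h2⟩

theorem Tight.edge {n : ℕ} {H : Finset (Finset (Fin n))} :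
    ∀ {l : List (Fin n)}, Tight H l → ∀ (i : ℕ) (h : i + 2 < l.length),
      Edge H l[i] l[i + 1] l[i + 2]
  | [], _, i, h => by simp at h
  | [_], _, i, h => by simp at h
  | [_, _], _, i, h => by simp at h
  | a :: b :: c :: l, ht, 0, h => ht.1
  | a :: b :: c :: l, ht, i + 1, h =>
      Tight.edge (l := b :: c :: l) ht.2 i (by simpa using h)

/-- `l` is a tight path whose first two vertices are `e.1` and last two vertices are `e.2`. -/
def PieceOf {n : ℕ} (H : Finset (Finset (Fin n))) (e : (Fin n × Fin n) × (Fin n × Fin n))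
    (l : List (Fin n)) : Prop :=
  Tight H l ∧ ∃ m, l = e.1.1 :: e.1.2 :: (m ++ [e.2.1, e.2.2])

/-- `l` joins the pair `(a, b)` to the pair `(p, q)`. -/
def Joins {n : ℕ} (H : Finset (Finset (Fin n))) (e : Fin n × Fin n) (f : Fin n × Fin n)
    (l : List (Fin n)) : Prop :=
  Tight H (e.1 :: e.2 :: (l ++ [f.1, f.2]))

theorem PieceOf.join {n : ℕ} {H : Finset (Finset (Fin n))} {e f : (Fin n × Fin n) × (Fin n × Fin n)}
    {P C Q : List (Fin n)} (hP : PieceOf H e P) (hC : Joins H e.2 f.1 C) (hQ : PieceOf H f Q) :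
    PieceOf H (e.1, f.2) (P ++ C ++ Q) := by
  obtain ⟨tP, m, rfl⟩ := hP
  obtain ⟨tQ, m', rfl⟩ := hQ
  refine ⟨?_, m ++ [e.2.1, e.2.2] ++ C ++ f.1.1 :: f.1.2 :: m', by simp⟩
  have h1 := tight_glue (A := e.2.1 :: e.2.2 :: C) (by simpa [Joins] using hC) tQ
  have h2 := tight_glue (A := e.1.1 :: e.1.2 :: m) (by simpa using tP) h1
  simpa using h2

theorem PieceOf.ne {n : ℕ} {H : Finset (Finset (Fin n))}
    {e : (Fin n × Fin n) × (Fin n × Fin n)} {P : List (Fin n)}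
    (hP : PieceOf H e P) (hd : P.Nodup) : e.1.1 ≠ e.1.2 ∧ e.2.1 ≠ e.2.2 := by
  obtain ⟨-, m, rfl⟩ := hP
  simp only [List.nodup_cons, List.mem_cons, List.nodup_append] at hd
  simp at hd
  tauto

theorem exists_pieceOf {n : ℕ} {H : Finset (Finset (Fin n))} {P : List (Fin n)} (hP : Tight H P)
    (h4 : 4 ≤ P.length) : ∃ e, PieceOf H e P := by
  match P, h4 with
  | a :: b :: l, h4 =>
    rcases List.eq_nil_or_concat l with rfl | ⟨l', q, rfl⟩
    · simp at h4
    rcases List.eq_nil_or_concat l' with rfl | ⟨m, p, rfl⟩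
    · simp at h4
    exact ⟨((a, b), (p, q)), hP, m, by simp⟩

theorem exists_image_card {α β γ : Type*} (I : Finset α) (T : α → Finset β) (f : α → β → γ)
    (hf : ∀ a b a' b', f a b = f a' b' → a = a' ∧ b = b') {c d : ℝ} (hc : c ≤ I.card)
    (hd0 : 0 ≤ d) (hd : ∀ a ∈ I, d ≤ (T a).card) :
    ∃ S : Finset γ, (∀ s ∈ S, ∃ a ∈ I, ∃ b ∈ T a, f a b = s) ∧ c * d ≤ S.card := by
  refine ⟨(I.sigma T).image fun x => f x.1 x.2, ?_, ?_⟩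
  · intro s hs
    simp only [mem_image, mem_sigma] at hs
    obtain ⟨⟨a, b⟩, ⟨ha, hb⟩, h⟩ := hs
    exact ⟨a, ha, b, hb, h⟩
  · rw [card_image_of_injective, card_sigma]
    · push_cast
      calc c * d ≤ I.card * d := by gcongr
        _ = ∑ a ∈ I, d := by simp
        _ ≤ _ := sum_le_sum hd
    · rintro ⟨a, b⟩ ⟨a', b'⟩ h
      obtain ⟨rfl, rfl⟩ := hf _ _ _ _ h
      rfl

theorem card_val_le (n : ℕ) {t : ℝ} (ht : 0 ≤ t) :
    (((univ : Finset (Fin n)).filter fun v : Fin n => ((v : ℕ) : ℝ) ≤ t).card : ℝ) ≤ t + 1 := by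
  have h : ((univ : Finset (Fin n)).filter fun v : Fin n => ((v : ℕ) : ℝ) ≤ t).card ≤ ⌊t⌋₊ + 1 := by
    rw [← card_range (⌊t⌋₊ + 1)]
    refine card_le_card_of_injOn (fun v => (v : ℕ)) ?_ ?_
    · intro v hv
      simp only [coe_filter, mem_univ, true_and, Set.mem_ofPred_eq] at hv
      simp [Nat.le_floor hv]
    · intro a _ b _ h
      exact Fin.ext h
  have h2 := Nat.floor_le ht
  have : (((univ : Finset (Fin n)).filter fun v : Fin n => ((v : ℕ) : ℝ) ≤ t).card : ℝ) ≤ ⌊t⌋₊ + 1 := by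
    exact_mod_cast h
  linarith

theorem card_filter_val_ge {n : ℕ} (A : Finset (Fin n)) {t : ℝ} (ht : 0 ≤ t) :
    (A.card : ℝ) - t - 1 ≤ (A.filter fun v : Fin n => t ≤ ((v : ℕ) : ℝ)).card := by
  have h1 := card_filter_add_card_filter_not (s := A) (fun v : Fin n => t ≤ ((v : ℕ) : ℝ))
  have h2 : (A.filter fun v : Fin n => ¬ t ≤ ((v : ℕ) : ℝ)).card ≤
      ((univ : Finset (Fin n)).filter fun v : Fin n => ((v : ℕ) : ℝ) ≤ t).card := by
    apply card_le_card
    intro v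
    simp only [mem_filter, mem_univ, true_and, not_le]
    exact fun h => h.2.le
  have h3 := card_val_le n ht
  have h2' : ((A.filter fun v : Fin n => ¬ t ≤ ((v : ℕ) : ℝ)).card : ℝ) ≤
      ((univ : Finset (Fin n)).filter fun v : Fin n => ((v : ℕ) : ℝ) ≤ t).card := by exact_mod_cast h2
  have h1' : ((A.filter fun v : Fin n => t ≤ ((v : ℕ) : ℝ)).card : ℝ) +
    (A.filter fun v : Fin n => ¬ t ≤ ((v : ℕ) : ℝ)).card = A.card := by exact_mod_cast h1
  linarith

theorem card_inter_ge {n : ℕ} (A B : Finset (Fin n)) :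
    (A.card : ℝ) + B.card - n ≤ (A ∩ B).card := by
  have h1 := card_union_add_card_inter A B
  have h2 : (A ∪ B).card ≤ n := by simpa using card_le_univ (A ∪ B)
  have h1' : ((A ∪ B).card : ℝ) + (A ∩ B).card = A.card + B.card := by exact_mod_cast h1
  have h2' : ((A ∪ B).card : ℝ) ≤ n := by exact_mod_cast h2
  linarith

/-- The vertices of the largest labels. -/
def topSet (γ : ℝ) (n : ℕ) : Finset (Fin n) :=
  univ.filter fun v : Fin n => (1 - γ) * n ≤ ((v : ℕ) : ℝ)

theorem card_topSet {γ : ℝ} (hγ : γ ≤ 1) (n : ℕ) : γ * n - 1 ≤ (topSet γ n).card := by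
  have := card_filter_val_ge (univ : Finset (Fin n)) (t := (1 - γ) * n)
    (mul_nonneg (by linarith) (by positivity))
  simp only [card_univ, Fintype.card_fin] at this
  unfold topSet
  linarith

theorem PosaCond.top_deg {γ : ℝ} {n : ℕ} {H : Finset (Finset (Fin n))}
    (hH : PosaCond γ n H) (hγ0 : 0 ≤ γ) {u y : Fin n} (hu : u ∈ topSet γ n) (h : u ≠ y) :
    n / 2 + γ * n / 2 ≤ ((nbr H u y).card : ℝ) := by
  have h1 := hH.deg u y h
  simp only [topSet, mem_filter, mem_univ, true_and] at hu
  have h2 : (n : ℝ) / 2 - γ * n / 2 ≤ min (((u : ℕ) + (y : ℕ) : ℝ) / 2) ((n : ℝ) / 2) := by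
    apply le_min
    · have : (0 : ℝ) ≤ (y : ℕ) := by positivity
      linarith
    · have : (0 : ℝ) ≤ γ * n := by positivity
      linarith
  linarith

theorem PosaCond.half_deg {γ : ℝ} {n : ℕ} {H : Finset (Finset (Fin n))}
    (hH : PosaCond γ n H) {x y : Fin n} (hx : (n : ℝ) / 2 ≤ (x : ℕ)) (hy : (n : ℝ) / 2 ≤ (y : ℕ))
    (h : x ≠ y) : n / 2 + γ * n ≤ ((nbr H x y).card : ℝ) := by
  have h1 := hH.deg x y h
  rw [min_eq_right (by linarith)] at h1
  exact h1

theorem PosaCond.climb {γ : ℝ} {n : ℕ} {H : Finset (Finset (Fin n))}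
    (hH : PosaCond γ n H) (hγ0 : 0 < γ) (hn : 4 ≤ γ * n) {t : ℝ} (ht : t ≤ n / 2)
    {a b : Fin n} (hab : a ≠ b) (ha : t ≤ (a : ℕ)) (hb : t ≤ (b : ℕ)) :
    γ / 4 * n ≤ ((nbr H a b).filter fun x : Fin n => t + γ / 2 * n ≤ ((x : ℕ) : ℝ)).card := by
  have h1 := hH.deg a b hab
  have h2 : max t 0 ≤ min (((a : ℕ) + (b : ℕ) : ℝ) / 2) ((n : ℝ) / 2) := by
    apply le_min
    · exact max_le (by linarith) (by positivity)
    · exact max_le ht (by positivity)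
  have h3 := card_filter_val_ge (nbr H a b) (t := max t 0 + γ / 2 * n) (by positivity)
  have h4 : ((nbr H a b).filter fun x : Fin n => max t 0 + γ / 2 * n ≤ ((x : ℕ) : ℝ)).card ≤
      ((nbr H a b).filter fun x : Fin n => t + γ / 2 * n ≤ ((x : ℕ) : ℝ)).card := by
    apply card_le_card
    intro x
    simp only [mem_filter]
    have := le_max_left t 0
    exact fun h => ⟨h.1, by linarith [h.2]⟩
  have h4' : (((nbr H a b).filter fun x : Fin n => max t 0 + γ / 2 * n ≤ ((x : ℕ) : ℝ)).card : ℝ) ≤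
      ((nbr H a b).filter fun x : Fin n => t + γ / 2 * n ≤ ((x : ℕ) : ℝ)).card := by exact_mod_cast h4
  linarith

/-- At least `c * n ^ L` lists of length `L` join `e` to `f`. -/
def ManyJoins {n : ℕ} (H : Finset (Finset (Fin n))) (c : ℝ) (L : ℕ) (e f : Fin n × Fin n) : Prop :=
  ∃ S : Finset (List (Fin n)), (∀ l ∈ S, l.length = L ∧ Joins H e f l) ∧ c * (n : ℝ) ^ L ≤ S.card

theorem ManyJoins.cons {n : ℕ} {H : Finset (Finset (Fin n))} {c δ : ℝ} (hc : 0 ≤ c) {L : ℕ}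
    {a b : Fin n} {f : Fin n × Fin n} {I : Finset (Fin n)} (hI : δ * n ≤ I.card)
    (hE : ∀ x ∈ I, Edge H a b x) (hJ : ∀ x ∈ I, ManyJoins H c L (b, x) f) :
    ManyJoins H (δ * c) (L + 1) (a, b) f := by
  choose! S hS hcard using hJ
  obtain ⟨S', h1, h2⟩ := exists_image_card I S (fun x l => x :: l) (by simp) hI
    (by positivity) hcard
  refine ⟨S', ?_, by rw [pow_succ]; linarith⟩
  intro s hs
  obtain ⟨x, hx, l, hl, rfl⟩ := h1 s hs
  refine ⟨by simp [(hS x hx l hl).1], ?_⟩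
  exact ⟨hE x hx, (hS x hx l hl).2⟩

theorem ManyJoins.snoc {n : ℕ} {H : Finset (Finset (Fin n))} {c δ : ℝ} (hc : 0 ≤ c) {L : ℕ}
    {p q : Fin n} {e : Fin n × Fin n} {I : Finset (Fin n)} (hI : δ * n ≤ I.card)
    (hE : ∀ x ∈ I, Edge H x p q) (hJ : ∀ x ∈ I, ManyJoins H c L e (x, p)) :
    ManyJoins H (δ * c) (L + 1) e (p, q) := by
  choose! S hS hcard using hJ
  obtain ⟨S', h1, h2⟩ := exists_image_card I S (fun x l => l ++ [x])
    (by intro a b a' b' h; have := List.append_inj' h rfl; simp_all) hI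
    (by positivity) hcard
  refine ⟨S', ?_, by rw [pow_succ]; linarith⟩
  intro s hs
  obtain ⟨x, hx, l, hl, rfl⟩ := h1 s hs
  refine ⟨by simp [(hS x hx l hl).1], ?_⟩
  have := tight_glue (H := H) (A := e.1 :: e.2 :: l) (p := x) (q := p) (B := [q])
    (by simpa [Joins] using (hS x hx l hl).2) (by simp [Tight, hE x hx])
  simpa [Joins] using this

theorem PosaCond.manyJoins_high {γ : ℝ} {n : ℕ} {H : Finset (Finset (Fin n))}
    (hH : PosaCond γ n H) (hγ0 : 0 < γ) (hγ1 : γ ≤ 1) (hn : 6 ≤ γ * n) {v x x' v' : Fin n}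
    (hvx : v ≠ x) (hv : (n : ℝ) / 2 ≤ (v : ℕ)) (hx : (n : ℝ) / 2 ≤ (x : ℕ))
    (hvx' : x' ≠ v') (hv' : (n : ℝ) / 2 ≤ (v' : ℕ)) (hx' : (n : ℝ) / 2 ≤ (x' : ℕ)) :
    ManyJoins H (γ ^ 10 / 4) 6 (v, x) (x', v') := by
  have hn0 : (0 : ℝ) < n := by
    rcases Nat.eq_zero_or_pos n with rfl | h
    · simp at hn; linarith
    · exact_mod_cast h
  set R : Fin n → Fin n × Fin n × Fin n × Fin n → Prop := fun u r =>
    Edge H v x r.1 ∧ Edge H x r.1 u ∧ Edge H r.1 u r.2.1 ∧ Edge H u r.2.1 r.2.2.1 ∧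
    Edge H r.2.1 r.2.2.1 u ∧ Edge H r.2.2.1 u r.2.2.2 ∧ Edge H u r.2.2.2 x' ∧
    Edge H r.2.2.2 x' v' with hR
  set T := topSet γ n \ {x, x'} with hT
  have hTc : γ / 2 * n ≤ T.card := by
    have h1 := card_topSet hγ1 n
    have h2 : (topSet γ n).card ≤ T.card + 2 :=
      (card_le_card_sdiff_add_card (s := topSet γ n) (t := {x, x'})).trans
        (Nat.add_le_add_left card_le_two _)
    have h2' : ((topSet γ n).card : ℝ) ≤ T.card + 2 := by exact_mod_cast h2
    linarith
  have key : ∀ u ∈ T, γ ^ 4 * (n : ℝ) ^ 4 ≤ ((univ.filter (R u)).card : ℝ) := by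
    intro u hu
    simp only [hT, mem_sdiff, mem_insert, mem_singleton, not_or] at hu
    obtain ⟨hu, hux, hux'⟩ := hu
    have hγn : (0 : ℝ) ≤ γ * n := by positivity
    have hY : γ * n ≤ ((nbr H v x ∩ nbr H u x).card : ℝ) := by
      have := card_inter_ge (nbr H v x) (nbr H u x)
      have := hH.half_deg hv hx hvx
      have := hH.top_deg hγ0.le hu hux
      linarith
    have hY' : γ * n ≤ ((nbr H x' v' ∩ nbr H u x').card : ℝ) := by
      have := card_inter_ge (nbr H x' v') (nbr H u x')
      have := hH.half_deg hx' hv' hvx'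
      have := hH.top_deg hγ0.le hu hux'
      linarith
    have hP : ∀ y ∈ nbr H v x ∩ nbr H u x, γ * n ≤ ((nbr H u y).card : ℝ) := by
      intro y hy
      simp only [mem_inter, mem_nbr] at hy
      have := hH.top_deg hγ0.le hu (Edge.ne hH.three hy.2).2.2
      nlinarith
    have hQ : ∀ p y', Edge H u x' y' → u ≠ p →
        γ * n ≤ ((nbr H u p ∩ nbr H u y').card : ℝ) := by
      intro p y' hy' hp
      have := card_inter_ge (nbr H u p) (nbr H u y')
      have := hH.top_deg hγ0.le hu (Edge.ne hH.three hy').2.2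
      have := hH.top_deg hγ0.le hu hp
      linarith
    obtain ⟨S1, hS1, hS1c⟩ := exists_image_card _ (fun y => nbr H u y)
      (fun y p => (y, p)) (by simp) hY hγn hP
    obtain ⟨S2, hS2, hS2c⟩ := exists_image_card S1
      (fun _ => nbr H x' v' ∩ nbr H u x') (fun z y' => (z, y'))
      (by simp) hS1c hγn (fun _ _ => hY')
    have hS2' : ∀ z ∈ S2, Edge H v x z.1.1 ∧ Edge H u x z.1.1 ∧ Edge H u z.1.1 z.1.2 ∧
        Edge H x' v' z.2 ∧ Edge H u x' z.2 := by
      intro z hz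
      obtain ⟨w, hw, y', hy', rfl⟩ := hS2 z hz
      obtain ⟨y, hy, p, hp, rfl⟩ := hS1 w hw
      simp only [mem_inter, mem_nbr] at hy hy' hp
      exact ⟨hy.1, hy.2, hp, hy'.1, hy'.2⟩
    obtain ⟨S3, hS3, hS3c⟩ := exists_image_card S2
      (fun z => nbr H u z.1.2 ∩ nbr H u z.2) (fun z q => (z.1.1, z.1.2, q, z.2))
      (by rintro ⟨⟨a, b⟩, c⟩ q ⟨⟨a', b'⟩, c'⟩ q'; simp; tauto) hS2c hγn
      (fun z hz => hQ z.1.2 z.2 (hS2' z hz).2.2.2.2 (Edge.ne hH.three (hS2' z hz).2.2.1).2.2)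
    have : S3.card ≤ (univ.filter (R u)).card := by
      apply card_le_card
      intro r hr
      obtain ⟨⟨⟨y, p⟩, y'⟩, hz, q, hq, rfl⟩ := hS3 r hr
      obtain ⟨h1, h2, h3, h4, h5⟩ := hS2' _ hz
      simp only [mem_inter, mem_nbr] at h1 h2 h3 h4 h5 hq
      simp only [hR, mem_filter, mem_univ, true_and]
      exact ⟨h1, h2.rot, h3.swap, hq.1, hq.1.rot, hq.2.rot.rot, h5.rot.rot.swap,
        h4.rot.rot⟩
    calc γ ^ 4 * (n : ℝ) ^ 4 = γ * n * (γ * n) * (γ * n) * (γ * n) := by ring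
      _ ≤ S3.card := hS3c
      _ ≤ _ := by exact_mod_cast this
  set U : Fin n × Fin n × Fin n × Fin n → Finset (Fin n) := fun r => T.filter fun u => R u r
    with hU
  have hsum : γ ^ 5 / 2 * (n : ℝ) ^ 5 ≤ ∑ r, ((U r).card : ℝ) := by
    have h1 := sum_card_bipartiteAbove_eq_sum_card_bipartiteBelow (s := T) (t := univ) R
    simp only [bipartiteAbove, bipartiteBelow] at h1
    have h2 : ∑ r, ((U r).card : ℝ) = ∑ u ∈ T, ((univ.filter (R u)).card : ℝ) := by
      exact_mod_cast h1.symm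
    rw [h2]
    calc γ ^ 5 / 2 * (n : ℝ) ^ 5 = γ / 2 * n * (γ ^ 4 * (n : ℝ) ^ 4) := by ring
      _ ≤ T.card * (γ ^ 4 * (n : ℝ) ^ 4) := by gcongr
      _ = ∑ u ∈ T, γ ^ 4 * (n : ℝ) ^ 4 := by simp
      _ ≤ _ := sum_le_sum key
  have hsq : γ ^ 10 / 4 * (n : ℝ) ^ 6 ≤ ∑ r, ((U r).card : ℝ) ^ 2 := by
    have h1 := sq_sum_le_card_mul_sum_sq (s := univ) (f := fun r => ((U r).card : ℝ))
    have h2 : ((univ : Finset (Fin n × Fin n × Fin n × Fin n)).card : ℝ) = (n : ℝ) ^ 4 := by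
      simp; ring
    rw [h2] at h1
    have h3 : (γ ^ 5 / 2 * (n : ℝ) ^ 5) ^ 2 ≤ (∑ r, ((U r).card : ℝ)) ^ 2 := by gcongr
    have h4 : (n : ℝ) ^ 4 * (γ ^ 10 / 4 * (n : ℝ) ^ 6) ≤
        (n : ℝ) ^ 4 * ∑ r, ((U r).card : ℝ) ^ 2 := by
      refine le_trans (le_of_eq ?_) (h3.trans h1)
      ring
    exact le_of_mul_le_mul_left h4 (by positivity)
  refine ⟨(univ.sigma fun r => U r ×ˢ U r).image fun z =>
    [z.1.1, z.2.1, z.1.2.1, z.1.2.2.1, z.2.2, z.1.2.2.2], ?_, ?_⟩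
  · intro l hl
    simp only [mem_image, mem_sigma, mem_univ, true_and, mem_product] at hl
    obtain ⟨⟨⟨y, p, q, y'⟩, u, u'⟩, ⟨h1, h2⟩, rfl⟩ := hl
    simp only [hU, hR, mem_filter] at h1 h2
    refine ⟨rfl, ?_⟩
    simp only [Joins, List.cons_append, List.nil_append, Tight, and_true]
    tauto
  · rw [card_image_of_injective, card_sigma]
    · refine hsq.trans (le_of_eq ?_)
      push_cast
      exact sum_congr rfl fun r _ => by rw [card_product]; push_cast; ring
    · rintro ⟨⟨y, p, q, y'⟩, u, u'⟩ ⟨⟨y1, p1, q1, y1'⟩, u1, u1'⟩ h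
      simp at h
      obtain ⟨rfl, rfl, rfl, rfl, rfl, rfl⟩ := h
      rfl

theorem exists_manyJoins_of_labels {γ : ℝ} (hγ0 : 0 < γ) (hγ1 : γ ≤ 1) (i j : ℕ) :
    ∃ L : ℕ, ∃ c : ℝ, 0 < L ∧ 0 < c ∧ ∀ n : ℕ, 6 ≤ γ * n →
      ∀ H : Finset (Finset (Fin n)), PosaCond γ n H → ∀ e f : Fin n × Fin n,
      e.1 ≠ e.2 → f.1 ≠ f.2 →
      (1 / 2 - i * (γ / 2)) * n ≤ (e.1 : ℕ) → (1 / 2 - i * (γ / 2)) * n ≤ (e.2 : ℕ) →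
      (1 / 2 - j * (γ / 2)) * n ≤ (f.1 : ℕ) → (1 / 2 - j * (γ / 2)) * n ≤ (f.2 : ℕ) →
      ManyJoins H c L e f := by
  induction i with
  | zero =>
    induction j with
    | zero =>
      refine ⟨6, γ ^ 10 / 4, by norm_num, by positivity, ?_⟩
      rintro n hn H hH ⟨v, x⟩ ⟨x', v'⟩ h1 h2 h3 h4 h5 h6
      simp at h1 h2 h3 h4 h5 h6
      exact hH.manyJoins_high hγ0 hγ1 hn h1 (by linarith) (by linarith) h2 (by linarith)
        (by linarith)
    | succ j ih =>
      obtain ⟨L, c, -, hc, ih⟩ := ih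
      refine ⟨L + 1 + 1, γ / 4 * (γ / 4 * c), by omega, by positivity, ?_⟩
      rintro n hn H hH e ⟨p, q⟩ h1 h2 h3 h4 h5 h6
      simp only at h2 h5 h6
      have ht : (1 / 2 - ((j + 1 : ℕ) : ℝ) * (γ / 2)) * n ≤ n / 2 := by
        have : (0 : ℝ) ≤ ((j + 1 : ℕ) : ℝ) * (γ / 2) * n := by positivity
        linarith
      have hpos : 0 ≤ γ / 2 * n := by positivity
      refine ManyJoins.snoc (by positivity) (hH.climb hγ0 (by linarith) ht h2 h5 h6) ?_ ?_
      · intro x hx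
        exact (mem_nbr.1 (mem_filter.1 hx).1).rot.rot
      intro x hx
      obtain ⟨hx, hxl⟩ := mem_filter.1 hx
      have hne := Edge.ne hH.three (mem_nbr.1 hx)
      refine ManyJoins.snoc hc.le (hH.climb hγ0 (by linarith) ht hne.2.2.symm
        (by linarith) h5) ?_ ?_
      · intro y hy
        exact (mem_nbr.1 (mem_filter.1 hy).1).rot.rot
      intro y hy
      obtain ⟨hy, hyl⟩ := mem_filter.1 hy
      have hne' := Edge.ne hH.three (mem_nbr.1 hy)
      push_cast at hyl hxl
      exact ih n hn H hH e (y, x) h1 hne'.2.2.symm h3 h4 (by simp only; linarith)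
        (by simp only; linarith)
  | succ i ih =>
    obtain ⟨L, c, -, hc, ih⟩ := ih
    refine ⟨L + 1 + 1, γ / 4 * (γ / 4 * c), by omega, by positivity, ?_⟩
    rintro n hn H hH ⟨a, b⟩ f h1 h2 h3 h4 h5 h6
    simp only at h1 h3 h4
    have ht : (1 / 2 - ((i + 1 : ℕ) : ℝ) * (γ / 2)) * n ≤ n / 2 := by
      have : (0 : ℝ) ≤ ((i + 1 : ℕ) : ℝ) * (γ / 2) * n := by positivity
      linarith
    have hpos : 0 ≤ γ / 2 * n := by positivity
    refine ManyJoins.cons (by positivity) (hH.climb hγ0 (by linarith) ht h1 h3 h4) ?_ ?_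
    · intro x hx
      exact mem_nbr.1 (mem_filter.1 hx).1
    intro x hx
    obtain ⟨hx, hxl⟩ := mem_filter.1 hx
    have hne := Edge.ne hH.three (mem_nbr.1 hx)
    refine ManyJoins.cons hc.le (hH.climb hγ0 (by linarith) ht hne.2.1 h4
      (by linarith)) ?_ ?_
    · intro y hy
      exact mem_nbr.1 (mem_filter.1 hy).1
    intro y hy
    obtain ⟨hy, hyl⟩ := mem_filter.1 hy
    have hne' := Edge.ne hH.three (mem_nbr.1 hy)
    push_cast at hyl hxl
    exact ih n hn H hH (x, y) f hne'.2.1 h2 (by simp only; linarith)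
      (by simp only; linarith) h5 h6

/-- Any two pairs are joined by a positive proportion of the lists of some fixed length. -/
theorem exists_manyJoins {γ : ℝ} (hγ0 : 0 < γ) (hγ1 : γ ≤ 1) :
    ∃ L : ℕ, ∃ c : ℝ, 0 < L ∧ 0 < c ∧ ∀ n : ℕ, 6 ≤ γ * n →
      ∀ H : Finset (Finset (Fin n)), PosaCond γ n H → ∀ e f : Fin n × Fin n,
      e.1 ≠ e.2 → f.1 ≠ f.2 → ManyJoins H c L e f := by
  obtain ⟨k, hk⟩ := exists_nat_ge (1 / γ)
  obtain ⟨L, c, hL, hc, h⟩ := exists_manyJoins_of_labels hγ0 hγ1 k k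
  refine ⟨L, c, hL, hc, fun n hn H hH e f he hf => ?_⟩
  have h1 : 1 / 2 - k * (γ / 2) ≤ 0 := by
    rw [div_le_iff₀ hγ0] at hk
    linarith
  have h2 : ∀ x : ℕ, (1 / 2 - k * (γ / 2)) * n ≤ (x : ℝ) := fun x =>
    (mul_nonpos_of_nonpos_of_nonneg h1 (by positivity)).trans (by positivity)
  exact h n hn H hH e f he hf (h2 _) (h2 _) (h2 _) (h2 _)

theorem exists_walks {n : ℕ} (G : Fin n → Fin n → Prop) (hG : ∀ x y, G x y → G y x) {δ : ℝ}
    (hδ : 0 ≤ δ)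
    (h : δ * (n : ℝ) ^ 2 ≤
      ((univ : Finset (Fin n × Fin n)).filter fun p => G p.1 p.2).card) :
    ∃ S : Finset (Fin n × Fin n × Fin n × Fin n),
      (∀ w ∈ S, G w.1 w.2.1 ∧ G w.2.1 w.2.2.1 ∧ G w.2.2.1 w.2.2.2) ∧
      δ ^ 3 / 32 * (n : ℝ) ^ 4 ≤ S.card := by
  set N : Fin n → Finset (Fin n) := fun x => univ.filter (G x) with hN
  set P := (univ : Finset (Fin n × Fin n)).filter fun p => G p.1 p.2 with hP
  set low := (univ : Finset (Fin n)).filter fun x => ((N x).card : ℝ) < δ / 4 * n with hlow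
  set B := low.sigma N with hB
  have hBc : (B.card : ℝ) ≤ δ / 4 * (n : ℝ) ^ 2 := by
    rw [hB, card_sigma]
    push_cast
    calc ∑ x ∈ low, ((N x).card : ℝ) ≤ ∑ x ∈ low, δ / 4 * n :=
          sum_le_sum fun x hx => (mem_filter.1 hx).2.le
      _ = low.card * (δ / 4 * n) := by simp
      _ ≤ n * (δ / 4 * n) := by
          gcongr
          simpa using card_le_univ low
      _ = _ := by ring
  set I := P.filter fun p => p.1 ∉ low ∧ p.2 ∉ low with hI
  have hsub : P ⊆ I ∪ (B.image (fun z => (z.1, z.2)) ∪ B.image (fun z => (z.2, z.1))) := by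
    rintro ⟨x, y⟩ hxy
    have hxy' := (mem_filter.1 hxy).2
    simp only [mem_union, hI, mem_filter, mem_image, hB, mem_sigma]
    by_cases h1 : x ∈ low
    · exact Or.inr (Or.inl ⟨⟨x, y⟩, ⟨h1, by simpa [hN] using hxy'⟩, rfl⟩)
    by_cases h2 : y ∈ low
    · exact Or.inr (Or.inr ⟨⟨y, x⟩, ⟨h2, by simpa [hN] using hG _ _ hxy'⟩, rfl⟩)
    · exact Or.inl ⟨hxy, h1, h2⟩
  have hIc : δ / 2 * (n : ℝ) ^ 2 ≤ I.card := by
    have h1 : P.card ≤ I.card + (B.card + B.card) :=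
      (card_le_card hsub).trans <| (card_union_le _ _).trans <| Nat.add_le_add_left
        ((card_union_le _ _).trans (Nat.add_le_add card_image_le card_image_le)) _
    have h1' : (P.card : ℝ) ≤ I.card + (B.card + B.card) := by exact_mod_cast h1
    linarith
  obtain ⟨S, hS, hSc⟩ := exists_image_card I (fun p => N p.1 ×ˢ N p.2)
    (fun p q => (q.1, p.1, p.2, q.2))
    (by rintro ⟨a, b⟩ ⟨c, d⟩ ⟨a', b'⟩ ⟨c', d'⟩; simp; tauto) hIc
    (d := (δ / 4 * n) * (δ / 4 * n)) (by positivity)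
    (by
      rintro ⟨x, y⟩ hp
      have := (mem_filter.1 hp).2
      simp only [hlow, mem_filter, mem_univ, true_and, not_lt] at this
      rw [card_product]
      push_cast
      have h0 : 0 ≤ δ / 4 * n := by positivity
      exact mul_le_mul this.1 this.2 h0 (h0.trans this.1))
  refine ⟨S, ?_, le_trans (le_of_eq (by ring)) hSc⟩
  intro w hw
  obtain ⟨⟨x, y⟩, hp, ⟨a, b⟩, hab, rfl⟩ := hS w hw
  simp only [mem_product, hN, mem_filter, mem_univ, true_and] at hab
  exact ⟨hG _ _ hab.1, (mem_filter.1 (mem_filter.1 hp).1).2, hab.2⟩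

/-- `l` is a tight path into which the vertex `v` can be inserted keeping the ends. -/
def Absorber {n : ℕ} (H : Finset (Finset (Fin n))) (v : Fin n) (l : List (Fin n)) : Prop :=
  ∃ e, PieceOf H e l ∧ ∃ l', PieceOf H e l' ∧ l'.Perm (v :: l)

theorem card_topSet_sdiff {γ : ℝ} (hγ1 : γ ≤ 1) {n : ℕ} (hn : 6 ≤ γ * n) (x x' : Fin n) :
    γ / 2 * n ≤ ((topSet γ n \ {x, x'}).card : ℝ) := by
  have h1 := card_topSet hγ1 n
  have h2 : (topSet γ n).card ≤ (topSet γ n \ {x, x'}).card + 2 :=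
    (card_le_card_sdiff_add_card (s := topSet γ n) (t := {x, x'})).trans
      (Nat.add_le_add_left card_le_two _)
  have h2' : ((topSet γ n).card : ℝ) ≤ (topSet γ n \ {x, x'}).card + 2 := by exact_mod_cast h2
  linarith

theorem PosaCond.card_inter_nbr {γ : ℝ} {n : ℕ} {H : Finset (Finset (Fin n))}
    (hH : PosaCond γ n H) (hγ0 : 0 ≤ γ) {u u' y y' : Fin n} (hu : u ∈ topSet γ n)
    (hu' : u' ∈ topSet γ n) (h : u ≠ y) (h' : u' ≠ y') :
    γ * n ≤ ((nbr H u y ∩ nbr H u' y').card : ℝ) := by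
  have := card_inter_ge (nbr H u y) (nbr H u' y')
  have := hH.top_deg hγ0 hu h
  have := hH.top_deg hγ0 hu' h'
  linarith

theorem PosaCond.left_walks {γ : ℝ} {n : ℕ} {H : Finset (Finset (Fin n))}
    (hH : PosaCond γ n H) (hγ0 : 0 < γ) (hγ1 : γ ≤ 1) (hn : 6 ≤ γ * n) (u v : Fin n) :
    ∃ S : Finset (Fin n × Fin n × Fin n × Fin n),
      (∀ w ∈ S, (Edge H u w.1 w.2.1 ∧ Edge H v w.1 w.2.1) ∧
        (Edge H u w.2.1 w.2.2.1 ∧ Edge H v w.2.1 w.2.2.1) ∧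
        (Edge H u w.2.2.1 w.2.2.2 ∧ Edge H v w.2.2.1 w.2.2.2)) ∧
      (γ ^ 2 / 2) ^ 3 / 32 * (n : ℝ) ^ 4 ≤ S.card := by
  refine exists_walks (fun x y => Edge H u x y ∧ Edge H v x y)
    (fun x y h => ⟨h.1.rot.swap.rot.rot, h.2.rot.swap.rot.rot⟩) (by positivity) ?_
  obtain ⟨S, hS, hSc⟩ := exists_image_card (topSet γ n \ {u, v})
    (fun x => nbr H x u ∩ nbr H x v) (fun x y => (x, y)) (by simp)
    (card_topSet_sdiff hγ1 hn u v) (d := γ * n) (by positivity)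
    (by
      intro x hx
      simp only [mem_sdiff, mem_insert, mem_singleton, not_or] at hx
      exact hH.card_inter_nbr hγ0.le hx.1 hx.1 hx.2.1 hx.2.2)
  have hle : S.card ≤ ((univ : Finset (Fin n × Fin n)).filter
      fun p => Edge H u p.1 p.2 ∧ Edge H v p.1 p.2).card := by
    apply card_le_card
    intro p hp
    obtain ⟨x, hx, y, hy, rfl⟩ := hS p hp
    simp only [mem_inter, mem_nbr] at hy
    simp only [mem_filter, mem_univ, true_and]
    exact ⟨hy.1.swap, hy.2.swap⟩
  calc γ ^ 2 / 2 * (n : ℝ) ^ 2 = γ / 2 * n * (γ * n) := by ring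
    _ ≤ S.card := hSc
    _ ≤ _ := by
        rw [Nat.cast_le]
        convert hle

theorem PosaCond.right_paths {γ : ℝ} {n : ℕ} {H : Finset (Finset (Fin n))}
    (hH : PosaCond γ n H) (hγ0 : 0 < γ) (hγ1 : γ ≤ 1) (hn : 6 ≤ γ * n) {u : Fin n}
    (hu : u ∈ topSet γ n) :
    ∃ S : Finset (Fin n × Fin n × Fin n × Fin n),
      (∀ w ∈ S, Edge H u w.1 w.2.1 ∧ Edge H u w.2.1 w.2.2.1 ∧ Edge H u w.2.2.1 w.2.2.2 ∧
        Edge H w.1 w.2.1 w.2.2.1 ∧ Edge H w.2.1 w.2.2.1 w.2.2.2) ∧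
      γ ^ 4 / 2 * (n : ℝ) ^ 4 ≤ S.card := by
  have hγn : (0 : ℝ) ≤ γ * n := by positivity
  obtain ⟨S1, hS1, hS1c⟩ := exists_image_card (topSet γ n \ {u, u})
    (fun y2 => nbr H u y2 ∩ nbr H u y2) (fun y2 y3 => (y2, y3)) (by simp)
    (card_topSet_sdiff hγ1 hn u u) hγn
    (by
      intro x hx
      simp only [mem_sdiff, mem_insert, mem_singleton, not_or] at hx
      exact hH.card_inter_nbr hγ0.le hu hu (Ne.symm hx.2.1) (Ne.symm hx.2.1))
  have hS1' : ∀ z ∈ S1, z.1 ∈ topSet γ n ∧ Edge H u z.1 z.2 := by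
    intro z hz
    obtain ⟨x, hx, y, hy, rfl⟩ := hS1 z hz
    simp only [mem_inter, mem_nbr] at hy
    exact ⟨(mem_sdiff.1 hx).1, hy.1⟩
  obtain ⟨S2, hS2, hS2c⟩ := exists_image_card S1
    (fun z => (nbr H u z.1 ∩ nbr H z.1 z.2) ×ˢ (nbr H u z.2 ∩ nbr H z.1 z.2))
    (fun z w => (w.1, z.1, z.2, w.2))
    (by rintro ⟨a, b⟩ ⟨c, d⟩ ⟨a', b'⟩ ⟨c', d'⟩; simp; tauto) hS1c
    (d := γ * n * (γ * n)) (by positivity)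
    (by
      intro z hz
      obtain ⟨hz1, hz2⟩ := hS1' z hz
      have hne := Edge.ne hH.three hz2
      rw [card_product]
      push_cast
      have h1 := hH.card_inter_nbr hγ0.le hu hz1 hne.1 hne.2.1
      have h2 := hH.card_inter_nbr hγ0.le hu hz1 hne.2.2 hne.2.1
      exact mul_le_mul h1 h2 hγn (hγn.trans h1))
  refine ⟨S2, ?_, le_trans (le_of_eq (by ring)) hS2c⟩
  intro w hw
  obtain ⟨⟨y2, y3⟩, hz, ⟨y1, y4⟩, hy, rfl⟩ := hS2 w hw
  obtain ⟨-, h1⟩ := hS1' _ hz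
  simp only [mem_inter, mem_nbr, mem_product] at hy h1
  obtain ⟨⟨h2, h3⟩, h4, h5⟩ := hy
  exact ⟨h2.rot.swap.rot.rot, h1, h4, h3.rot.rot, h5⟩

theorem absorbs_of_edges {n : ℕ} {H : Finset (Finset (Fin n))} {u v : Fin n}
    {x y : Fin n × Fin n × Fin n × Fin n} {z : List (Fin n)}
    (hx : (Edge H u x.1 x.2.1 ∧ Edge H v x.1 x.2.1) ∧
        (Edge H u x.2.1 x.2.2.1 ∧ Edge H v x.2.1 x.2.2.1) ∧
        (Edge H u x.2.2.1 x.2.2.2 ∧ Edge H v x.2.2.1 x.2.2.2))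
    (hy : Edge H u y.1 y.2.1 ∧ Edge H u y.2.1 y.2.2.1 ∧ Edge H u y.2.2.1 y.2.2.2 ∧
        Edge H y.1 y.2.1 y.2.2.1 ∧ Edge H y.2.1 y.2.2.1 y.2.2.2)
    (hz : Joins H (x.2.2.1, x.2.2.2) (y.1, y.2.1) z) :
    Absorber H v (x.1 :: x.2.1 :: u :: x.2.2.1 :: x.2.2.2 ::
      (z ++ [y.1, y.2.1, y.2.2.1, y.2.2.2])) := by
  obtain ⟨x1, x2, x3, x4⟩ := x
  obtain ⟨y1, y2, y3, y4⟩ := y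
  simp only at hx hy hz ⊢
  obtain ⟨⟨a1, b1⟩, ⟨a2, b2⟩, a3, b3⟩ := hx
  obtain ⟨c1, c2, c3, c4, c5⟩ := hy
  refine ⟨((x1, x2), (y3, y4)), ⟨?_, u :: x3 :: x4 :: (z ++ [y1, y2]), by simp⟩,
    x1 :: x2 :: v :: x3 :: x4 :: (z ++ [y1, y2, u, y3, y4]),
    ⟨?_, v :: x3 :: x4 :: (z ++ [y1, y2, u]), by simp⟩, ?_⟩
  · have h := tight_glue (H := H) (A := x3 :: x4 :: z) (p := y1) (q := y2) (B := [y3, y4])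
      (by simpa [Joins] using hz) (by simp [Tight, c4, c5])
    simp only [List.cons_append] at h
    exact ⟨a1.rot, a2.swap, a3, h⟩
  · have h := tight_glue (H := H) (A := x3 :: x4 :: z) (p := y1) (q := y2) (B := [u, y3, y4])
      (by simpa [Joins] using hz) (by simp [Tight, c1.rot, c2.swap, c3])
    simp only [List.cons_append] at h
    exact ⟨b1.rot, b2.swap, b3, h⟩
  · rw [List.perm_iff_count]
    intro a
    simp only [List.count_cons, List.count_append, List.count_nil]
    omega

theorem exists_absorbers {γ : ℝ} (hγ0 : 0 < γ) (hγ1 : γ ≤ 1) :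
    ∃ K : ℕ, ∃ c : ℝ, 0 < K ∧ 0 < c ∧ ∀ n : ℕ, 6 ≤ γ * n →
      ∀ H : Finset (Finset (Fin n)), PosaCond γ n H → ∀ v : Fin n,
      ∃ S : Finset (List (Fin n)), (∀ l ∈ S, l.length = K ∧ Absorber H v l) ∧
        c * (n : ℝ) ^ K ≤ S.card := by
  obtain ⟨L, c, -, hc, hL⟩ := exists_manyJoins hγ0 hγ1
  refine ⟨L + 9, γ / 2 * ((γ ^ 2 / 2) ^ 3 / 32) * (γ ^ 4 / 2) * c, by omega, by positivity, ?_⟩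
  intro n hn H hH v
  choose W hW hWc using hH.left_walks hγ0 hγ1 hn (v := v)
  obtain ⟨S1, hS1, hS1c⟩ := exists_image_card (topSet γ n \ {v, v}) W
    (fun u w => (u, w)) (by simp) (card_topSet_sdiff hγ1 hn v v) (by positivity)
    (fun u _ => hWc u)
  choose! R hR hRc using fun u (hu : u ∈ topSet γ n) => hH.right_paths hγ0 hγ1 hn hu
  obtain ⟨S2, hS2, hS2c⟩ := exists_image_card S1 (fun z => R z.1)
    (fun z y => (z, y)) (by simp) hS1c (d := γ ^ 4 / 2 * (n : ℝ) ^ 4) (by positivity)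
    (by
      intro z hz
      obtain ⟨u, hu, w, hw, rfl⟩ := hS1 z hz
      exact hRc u (mem_sdiff.1 hu).1)
  have hS2' : ∀ s ∈ S2, s.1.1 ∈ topSet γ n ∧ s.1.2 ∈ W s.1.1 ∧ s.2 ∈ R s.1.1 := by
    intro s hs
    obtain ⟨z, hz, y, hy, rfl⟩ := hS2 s hs
    obtain ⟨u, hu, w, hw, rfl⟩ := hS1 z hz
    exact ⟨(mem_sdiff.1 hu).1, hw, hy⟩
  have hJ : ∀ s ∈ S2, ManyJoins H c L (s.1.2.2.2.1, s.1.2.2.2.2) (s.2.1, s.2.2.1) := by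
    intro s hs
    obtain ⟨h1, h2, h3⟩ := hS2' s hs
    exact hL n hn H hH _ _ (Edge.ne hH.three (hW _ _ h2).2.2.1).2.1
      (Edge.ne hH.three (hR _ h1 _ h3).1).2.1
  choose! J hJ hJc using hJ
  obtain ⟨S, hS, hSc⟩ := exists_image_card S2 J
    (fun s z => s.1.2.1 :: s.1.2.2.1 :: s.1.1 :: s.1.2.2.2.1 :: s.1.2.2.2.2 ::
      (z ++ [s.2.1, s.2.2.1, s.2.2.2.1, s.2.2.2.2]))
    (by
      rintro ⟨⟨u, x1, x2, x3, x4⟩, y1, y2, y3, y4⟩ z ⟨⟨u', x1', x2', x3', x4'⟩, y1', y2', y3', y4'⟩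
        z' h
      simp only [List.cons.injEq] at h
      obtain ⟨h1, h2, h3, h4, h5, h6⟩ := h
      have := List.append_inj' h6 rfl
      simp_all) hS2c (by positivity) hJc
  refine ⟨S, ?_, le_trans (le_of_eq (by ring)) hSc⟩
  intro l hl
  obtain ⟨s, hs, z, hz, rfl⟩ := hS l hl
  obtain ⟨h1, h2, h3⟩ := hS2' s hs
  obtain ⟨h4, h5⟩ := hJ s hs z hz
  exact ⟨by simp [h4], absorbs_of_edges (hW _ _ h2) (hR _ h1 _ h3) h5⟩

/-- All lists of length `k`. -/
def allLists (n : ℕ) : ℕ → Finset (List (Fin n))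
  | 0 => {[]}
  | k + 1 => ((univ : Finset (Fin n)) ×ˢ allLists n k).image fun p => p.1 :: p.2

theorem mem_allLists {n : ℕ} : ∀ {k : ℕ} {l : List (Fin n)}, l ∈ allLists n k ↔ l.length = k
  | 0, l => by simp [allLists]
  | k + 1, [] => by simp [allLists]
  | k + 1, x :: l => by simp [allLists, mem_allLists (k := k)]

theorem card_allLists (n : ℕ) : ∀ k : ℕ, (allLists n k).card = n ^ k
  | 0 => by simp [allLists]
  | k + 1 => by
      rw [allLists, card_image_of_injective _ (by rintro ⟨a, b⟩ ⟨c, d⟩; simp), card_product,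
        card_allLists n k]
      simp [pow_succ, mul_comm]

theorem card_bad_lists {n : ℕ} (Q : Finset (Fin n)) : ∀ k : ℕ,
    ((allLists n k).filter fun l => ¬ (l.Nodup ∧ ∀ x ∈ l, x ∉ Q)).card * n ≤
      k * (Q.card + k) * n ^ k
  | 0 => by simp [allLists]
  | k + 1 => by
      have ih := card_bad_lists Q k
      set B := (allLists n k).filter fun l => ¬ (l.Nodup ∧ ∀ x ∈ l, x ∉ Q) with hB
      have hsub : ((allLists n (k + 1)).filter fun l => ¬ (l.Nodup ∧ ∀ x ∈ l, x ∉ Q)) ⊆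
          ((univ ×ˢ B).image fun p => p.1 :: p.2) ∪
            (((Q ×ˢ allLists n k).image fun p => p.1 :: p.2) ∪
              (((allLists n k).sigma fun l => l.toFinset).image fun p => p.2 :: p.1)) := by
        intro l hl
        simp only [mem_filter, mem_allLists] at hl
        obtain ⟨hl, hbad⟩ := hl
        match l, hl with
        | x :: l, hl =>
          simp only [List.length_cons, Nat.add_right_cancel_iff] at hl
          simp only [mem_union, mem_image, mem_product, mem_univ, true_and, mem_sigma, hB,
            mem_filter, mem_allLists, Prod.exists, Sigma.exists, List.mem_toFinset]
          by_cases h1 : x ∈ Q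
          · exact Or.inr (Or.inl ⟨x, l, ⟨h1, hl⟩, rfl⟩)
          by_cases h2 : x ∈ l
          · exact Or.inr (Or.inr ⟨l, x, ⟨hl, h2⟩, rfl⟩)
          refine Or.inl ⟨x, l, ⟨hl, ?_⟩, rfl⟩
          rintro ⟨h3, h4⟩
          refine hbad ⟨List.nodup_cons.2 ⟨h2, h3⟩, ?_⟩
          simpa [h1] using h4
      have h1 : ((univ : Finset (Fin n)) ×ˢ B).card = n * B.card := by simp
      have h2 : (Q ×ˢ allLists n k).card = Q.card * n ^ k := by
        rw [card_product, card_allLists]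
      have h3 : ((allLists n k).sigma fun l => l.toFinset).card ≤ n ^ k * k := by
        rw [card_sigma, ← card_allLists n k, ← smul_eq_mul]
        refine sum_le_card_nsmul _ _ _ fun l hl => ?_
        exact (List.toFinset_card_le l).trans (mem_allLists.1 hl).le
      have h4 := (card_le_card hsub).trans <| (card_union_le _ _).trans <|
        Nat.add_le_add card_image_le <|
        (card_union_le _ _).trans (Nat.add_le_add card_image_le card_image_le)
      rw [h1, h2] at h4
      calc _ ≤ (n * B.card + (Q.card * n ^ k + n ^ k * k)) * n :=
            Nat.mul_le_mul_right _ (h4.trans (by omega))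
        _ = n * (B.card * n) + (Q.card + k) * (n ^ k * n) := by ring
        _ ≤ n * (k * (Q.card + k) * n ^ k) + (Q.card + k) * (n ^ k * n) := by gcongr
        _ = (k + 1) * (Q.card + k) * n ^ (k + 1) := by ring
        _ ≤ (k + 1) * (Q.card + (k + 1)) * n ^ (k + 1) := by gcongr; omega

/-- One step of the greedy choice: some admissible list decreases the potential. -/
theorem exists_good_list {n k : ℕ} {c : ℝ} (hc0 : 0 < c) (hn : 0 < n) {ι : Type}
    {s : Finset ι} (hs : s.Nonempty) {A : ι → Finset (List (Fin n))}
    (hA : ∀ i ∈ s, (∀ l ∈ A i, l.length = k) ∧ c * (n : ℝ) ^ k ≤ (A i).card)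
    {Q : Finset (Fin n)} (hQ : k * ((Q.card : ℝ) + k) ≤ c / 2 * n) (w : ι → ℝ)
    (hw : ∀ i, 0 ≤ w i) :
    ∃ l, l.Nodup ∧ (∀ x ∈ l, x ∉ Q) ∧ (∃ i ∈ s, l ∈ A i) ∧
      ∑ i ∈ s, w i * (if l ∈ A i then 1 / 2 else 1) ≤ (1 - c / 4) * ∑ i ∈ s, w i := by
  have hn' : (0 : ℝ) < n := by exact_mod_cast hn
  set G := (s.biUnion A).filter fun l => l.Nodup ∧ ∀ x ∈ l, x ∉ Q with hG
  have hGc : (G.card : ℝ) ≤ (n : ℝ) ^ k := by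
    have : G.card ≤ (allLists n k).card := by
      apply card_le_card
      intro l hl
      simp only [hG, mem_filter, mem_biUnion] at hl
      obtain ⟨⟨i, hi, hl⟩, -⟩ := hl
      exact mem_allLists.2 ((hA i hi).1 l hl)
    rw [card_allLists] at this
    exact_mod_cast this
  have hAG : ∀ i ∈ s, c / 2 * (n : ℝ) ^ k ≤ ((G.filter fun l => l ∈ A i).card : ℝ) := by
    intro i hi
    set B := (allLists n k).filter fun l => ¬ (l.Nodup ∧ ∀ x ∈ l, x ∉ Q) with hB
    have hb : (B.card : ℝ) * n ≤ k * (Q.card + k) * (n : ℝ) ^ k := by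
      exact_mod_cast card_bad_lists Q k
    have hb2 : (B.card : ℝ) ≤ c / 2 * (n : ℝ) ^ k := by
      have : (B.card : ℝ) * n ≤ c / 2 * (n : ℝ) ^ k * n := by
        refine hb.trans ?_
        calc _ ≤ c / 2 * n * (n : ℝ) ^ k := by gcongr
          _ = _ := by ring
      exact le_of_mul_le_mul_right this hn'
    have hsub : A i ⊆ (G.filter fun l => l ∈ A i) ∪ B := by
      intro l hl
      simp only [mem_union, hG, hB, mem_filter, mem_biUnion, mem_allLists]
      have h1 := (hA i hi).1 l hl
      by_cases h2 : l.Nodup ∧ ∀ x ∈ l, x ∉ Q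
      · exact Or.inl ⟨⟨⟨i, hi, hl⟩, h2⟩, hl⟩
      · exact Or.inr ⟨h1, h2⟩
    have h3 : ((A i).card : ℝ) ≤ (G.filter fun l => l ∈ A i).card + B.card := by
      exact_mod_cast (card_le_card hsub).trans (card_union_le _ _)
    have := (hA i hi).2
    linarith
  have hGne : G.Nonempty := by
    obtain ⟨i, hi⟩ := hs
    have h1 := hAG i hi
    have h2 : (0 : ℝ) < c / 2 * (n : ℝ) ^ k := by positivity
    have h3 : 0 < (G.filter fun l => l ∈ A i).card := by exact_mod_cast h2.trans_le h1
    obtain ⟨l, hl⟩ := card_pos.1 h3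
    exact ⟨l, (mem_filter.1 hl).1⟩
  have hsum : ∑ l ∈ G, ∑ i ∈ s, w i * (if l ∈ A i then 1 / 2 else 1) ≤
      ∑ l ∈ G, (1 - c / 4) * ∑ i ∈ s, w i := by
    rw [sum_comm, sum_const, nsmul_eq_mul, mul_sum, mul_sum]
    refine sum_le_sum fun i hi => ?_
    rw [← mul_sum]
    have h1 : ∑ l ∈ G, (if l ∈ A i then (1 / 2 : ℝ) else 1) =
        G.card - 1 / 2 * (G.filter fun l => l ∈ A i).card := by
      have : ∀ l ∈ G, (if l ∈ A i then (1 / 2 : ℝ) else 1) =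
          1 - 1 / 2 * (if l ∈ A i then 1 else 0) := by
        intro l _
        split_ifs <;> norm_num
      rw [sum_congr rfl this, sum_sub_distrib, ← mul_sum, sum_boole]
      simp
    rw [h1]
    have h2 : (G.card : ℝ) - 1 / 2 * (G.filter fun l => l ∈ A i).card ≤
        G.card * (1 - c / 4) := by
      have := hAG i hi
      have : c / 4 * G.card ≤ c / 4 * (n : ℝ) ^ k := by gcongr
      linarith
    calc _ ≤ w i * (G.card * (1 - c / 4)) := by
          exact mul_le_mul_of_nonneg_left h2 (hw i)
      _ = _ := by ring
  obtain ⟨l, hl, hle⟩ := exists_le_of_sum_le hGne hsum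
  simp only [hG, mem_filter, mem_biUnion] at hl
  exact ⟨l, hl.2.1, hl.2.2, hl.1, hle⟩

theorem exists_selection_potential {n k : ℕ} {c : ℝ} (hc0 : 0 < c) (hc1 : c ≤ 1) (hn : 0 < n)
    {ι : Type} {s : Finset ι} (hs : s.Nonempty) {A : ι → Finset (List (Fin n))}
    (hA : ∀ i ∈ s, (∀ l ∈ A i, l.length = k) ∧ c * (n : ℝ) ^ k ≤ (A i).card)
    {Q : Finset (Fin n)} : ∀ M : ℕ, k * ((Q.card : ℝ) + k * M + k) ≤ c / 2 * n →
    ∃ F : List (List (Fin n)), F.length = M ∧ (∀ l ∈ F, ∃ i ∈ s, l ∈ A i) ∧ F.flatten.Nodup ∧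
      (∀ x ∈ F.flatten, x ∉ Q) ∧
      ∑ i ∈ s, (1 / 2 : ℝ) ^ (F.countP fun l => decide (l ∈ A i)) ≤ (1 - c / 4) ^ M * s.card
  | 0, _ => ⟨[], by simp⟩
  | M + 1, hM => by
      have hle : (k : ℝ) * ((Q.card : ℝ) + k * M + k) ≤ c / 2 * n := by
        refine le_trans ?_ hM
        push_cast
        gcongr
        linarith
      obtain ⟨F, h1, h2, h3, h4, h5⟩ := exists_selection_potential hc0 hc1 hn hs hA M hle
      have hlen : F.flatten.length = M * k := by
        rw [List.length_flatten, List.sum_eq_card_nsmul _ k, List.length_map, h1, smul_eq_mul]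
        intro x hx
        obtain ⟨l, hl, rfl⟩ := List.mem_map.1 hx
        obtain ⟨i, hi, hl⟩ := h2 l hl
        exact (hA i hi).1 l hl
      have hQ' : k * (((Q ∪ F.flatten.toFinset).card : ℝ) + k) ≤ c / 2 * n := by
        refine le_trans ?_ hle
        have : (Q ∪ F.flatten.toFinset).card ≤ Q.card + M * k :=
          (card_union_le _ _).trans
            (Nat.add_le_add_left ((List.toFinset_card_le _).trans hlen.le) _)
        have : ((Q ∪ F.flatten.toFinset).card : ℝ) ≤ Q.card + M * k := by exact_mod_cast this
        gcongr
        linarith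
      obtain ⟨l, hl1, hl2, hl3, hl4⟩ := exists_good_list hc0 hn hs hA hQ'
        (fun i => (1 / 2 : ℝ) ^ (F.countP fun l => decide (l ∈ A i))) (fun i => by positivity)
      simp only [mem_union, List.mem_toFinset, not_or] at hl2
      refine ⟨l :: F, by simp [h1], ?_, ?_, ?_, ?_⟩
      · intro l' hl'
        rcases List.mem_cons.1 hl' with rfl | hl'
        · exact hl3
        · exact h2 l' hl'
      · rw [List.flatten_cons, List.nodup_append]
        refine ⟨hl1, h3, ?_⟩
        rintro a ha b hb rfl
        exact (hl2 a ha).2 hb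
      · intro x hx
        rw [List.flatten_cons, List.mem_append] at hx
        rcases hx with hx | hx
        · exact (hl2 x hx).1
        · exact h4 x hx
      · calc _ = ∑ i ∈ s, (1 / 2 : ℝ) ^ (F.countP fun l => decide (l ∈ A i)) *
              (if l ∈ A i then 1 / 2 else 1) := by
              refine sum_congr rfl fun i _ => ?_
              rw [List.countP_cons]
              by_cases h : l ∈ A i <;> simp [h, pow_succ]
          _ ≤ (1 - c / 4) * ((1 - c / 4) ^ M * s.card) :=
              hl4.trans (mul_le_mul_of_nonneg_left h5 (by linarith))
          _ = _ := by ring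

theorem eventually_pow_lt_exp {a b : ℝ} (ha : 0 < a) :
    ∃ n₀ : ℕ, ∀ n : ℕ, n₀ ≤ n → (n : ℝ) ^ 4 < Real.exp (a * n - b) := by
  have h1 := (Real.tendsto_exp_div_pow_atTop 4).comp
    (tendsto_natCast_atTop_atTop.const_mul_atTop ha)
  obtain ⟨N, hN⟩ := Filter.eventually_atTop.1
    (h1.eventually_gt_atTop (Real.exp b / a ^ 4))
  refine ⟨N + 1, fun n hn => ?_⟩
  have h2 := hN n (by omega)
  have hn0 : (0 : ℝ) < n := by exact_mod_cast (by omega : 0 < n)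
  simp only [Function.comp] at h2
  rw [div_lt_div_iff₀ (by positivity) (by positivity)] at h2
  rw [Real.exp_sub, lt_div_iff₀ (Real.exp_pos b)]
  have : 0 < a ^ 4 := by positivity
  nlinarith

/-- Disjoint lists can be selected such that each of polynomially many dense families of lists
contains linearly many of them. -/
theorem exists_selection {k : ℕ} (hk : 0 < k) {c : ℝ} (hc0 : 0 < c) (hc1 : c ≤ 1) :
    ∃ β : ℝ, 0 < β ∧ ∀ ρ : ℝ, 0 < ρ → ρ ≤ β → ∃ κ : ℝ, 0 < κ ∧ ∃ n₀ : ℕ, ∀ n : ℕ, n₀ ≤ n →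
      ∀ {ι : Type} (s : Finset ι), s.card ≤ n ^ 4 → ∀ A : ι → Finset (List (Fin n)),
      (∀ i ∈ s, (∀ l ∈ A i, l.length = k) ∧ c * (n : ℝ) ^ k ≤ (A i).card) →
      ∀ Q : Finset (Fin n), (Q.card : ℝ) ≤ β * n →
      ∃ F : List (List (Fin n)), (F.length : ℝ) ≤ ρ * n ∧ (∀ l ∈ F, ∃ i ∈ s, l ∈ A i) ∧
        F.flatten.Nodup ∧ (∀ x ∈ F.flatten, x ∉ Q) ∧
        ∀ i ∈ s, κ * n ≤ (F.countP fun l => decide (l ∈ A i) : ℕ) := by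
  have hk' : (1 : ℝ) ≤ k := by exact_mod_cast hk
  refine ⟨c / (8 * k ^ 2), by positivity, fun ρ hρ0 hρ => ⟨c * ρ / 8, by positivity, ?_⟩⟩
  obtain ⟨N, hN⟩ := eventually_pow_lt_exp (a := c * ρ / 8) (b := c / 4) (by positivity)
  obtain ⟨N', hN'⟩ := exists_nat_ge (4 * k ^ 2 / c)
  refine ⟨max (N + 1) N', fun n hn ι s hs A hA Q hQ => ?_⟩
  have hn1 : 0 < n := by have := le_max_left (N + 1) N'; omega
  have hn2 : 4 * (k : ℝ) ^ 2 ≤ c * n := by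
    have : (N' : ℝ) ≤ n := by exact_mod_cast (le_max_right _ _).trans hn
    rw [div_le_iff₀ hc0] at hN'
    nlinarith
  have hn3 := hN n (by have := le_max_left (N + 1) N'; omega)
  rcases s.eq_empty_or_nonempty with rfl | hne
  · exact ⟨[], by simp; positivity⟩
  have hMle : (⌊ρ * n⌋₊ : ℝ) ≤ ρ * n := Nat.floor_le (by positivity)
  have hMlt : ρ * n < (⌊ρ * n⌋₊ : ℝ) + 1 := Nat.lt_floor_add_one _
  have hbound : k * ((Q.card : ℝ) + k * ⌊ρ * n⌋₊ + k) ≤ c / 2 * n := by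
    have h1 : (k : ℝ) ^ 2 * (c / (8 * k ^ 2) * n) = c / 8 * n := by field_simp
    have h2 : k * (Q.card : ℝ) ≤ c / 8 * n := by
      calc k * (Q.card : ℝ) ≤ (k : ℝ) ^ 2 * (c / (8 * k ^ 2) * n) := by
            have : (k : ℝ) ≤ k ^ 2 := by nlinarith
            gcongr
        _ = _ := h1
    have h3 : (k : ℝ) ^ 2 * ⌊ρ * n⌋₊ ≤ c / 8 * n := by
      calc (k : ℝ) ^ 2 * ⌊ρ * n⌋₊ ≤ (k : ℝ) ^ 2 * (c / (8 * k ^ 2) * n) := by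
            have : (⌊ρ * n⌋₊ : ℝ) ≤ c / (8 * k ^ 2) * n := hMle.trans (by gcongr)
            gcongr
        _ = _ := h1
    nlinarith
  obtain ⟨F, h1, h2, h3, h4, h5⟩ :=
    exists_selection_potential hc0 hc1 hn1 hne hA ⌊ρ * n⌋₊ hbound
  refine ⟨F, by rw [h1]; exact hMle, h2, h3, h4, fun i hi => ?_⟩
  by_contra! hlt
  have h6 : (1 / 2 : ℝ) ^ (F.countP fun l => decide (l ∈ A i)) ≤
      (1 - c / 4) ^ ⌊ρ * n⌋₊ * s.card :=
    le_trans (single_le_sum (f := fun i => (1 / 2 : ℝ) ^ (F.countP fun l => decide (l ∈ A i)))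
      (fun i _ => by positivity) hi) h5
  have h7 : Real.exp (-(F.countP fun l => decide (l ∈ A i) : ℕ)) ≤
      (1 / 2 : ℝ) ^ (F.countP fun l => decide (l ∈ A i)) := by
    have : Real.exp (-1) ≤ 1 / 2 := by
      rw [Real.exp_neg, one_div]
      gcongr
      linarith [Real.add_one_le_exp (1 : ℝ)]
    calc Real.exp (-(F.countP fun l => decide (l ∈ A i) : ℕ)) =
        Real.exp (-1) ^ (F.countP fun l => decide (l ∈ A i)) := by
          rw [← Real.exp_nat_mul]; ring_nf
      _ ≤ _ := by gcongr
  have h8 : (1 - c / 4) ^ ⌊ρ * n⌋₊ ≤ Real.exp (-(c / 4) * ⌊ρ * n⌋₊) := by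
    have : 1 - c / 4 ≤ Real.exp (-(c / 4)) := by linarith [Real.add_one_le_exp (-(c / 4))]
    rw [mul_comm (-(c / 4)), Real.exp_nat_mul]
    have h0 : 0 ≤ 1 - c / 4 := by linarith
    gcongr
  have h9 : (s.card : ℝ) ≤ (n : ℝ) ^ 4 := by exact_mod_cast hs
  have h10 : Real.exp (-(F.countP fun l => decide (l ∈ A i) : ℕ)) <
      Real.exp (-(c / 4) * ⌊ρ * n⌋₊) * Real.exp (c * ρ / 8 * n - c / 4) := by
    calc _ ≤ (1 - c / 4) ^ ⌊ρ * n⌋₊ * (s.card : ℝ) := h7.trans h6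
      _ ≤ Real.exp (-(c / 4) * ⌊ρ * n⌋₊) * (n : ℝ) ^ 4 := by gcongr
      _ < _ := by gcongr
  rw [← Real.exp_add, Real.exp_lt_exp] at h10
  nlinarith

theorem exists_subset_average {α : Type*} (f : α → ℕ) (U : Finset α) {t : ℕ} (ht : t ≤ U.card) :
    ∃ U₀ ⊆ U, U₀.card = t ∧ t * ∑ x ∈ U, f x ≤ U.card * ∑ x ∈ U₀, f x := by
  obtain ⟨U₀, hU₀, hmax⟩ := exists_max_image (powersetCard t U) (fun S => ∑ x ∈ S, f x)
    (powersetCard_nonempty.2 ht)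
  obtain ⟨hsub, hcard⟩ := mem_powersetCard.1 hU₀
  refine ⟨U₀, hsub, hcard, ?_⟩
  have hle : ∀ x ∈ U₀, ∀ y ∈ U \ U₀, f y ≤ f x := by
    intro x hx y hy
    obtain ⟨hyU, hyU₀⟩ := mem_sdiff.1 hy
    have hy' : y ∉ U₀.erase x := fun h => hyU₀ (mem_of_mem_erase h)
    have h1 := hmax (insert y (U₀.erase x)) (by
      refine mem_powersetCard.2 ⟨?_, ?_⟩
      · intro z hz
        rcases mem_insert.1 hz with rfl | hz
        · exact hyU
        · exact hsub (mem_of_mem_erase hz)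
      · rw [card_insert_of_notMem hy', card_erase_add_one hx, hcard])
    rw [sum_insert hy'] at h1
    have h2 := add_sum_erase U₀ f hx
    omega
  have h1 : ∑ x ∈ U₀, ∑ y ∈ U \ U₀, f y ≤ ∑ x ∈ U₀, ∑ y ∈ U \ U₀, f x :=
    sum_le_sum fun x hx => sum_le_sum fun y hy => hle x hx y hy
  simp only [sum_const, smul_eq_mul] at h1
  rw [← mul_sum, hcard, card_sdiff_of_subset hsub, hcard] at h1
  rw [← sum_sdiff hsub]
  obtain ⟨r, hr⟩ := Nat.exists_eq_add_of_le ht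
  rw [hr] at h1 ⊢
  rw [Nat.add_sub_cancel_left] at h1
  nlinarith

theorem sum_card_filter_mem {α β : Type*} (U : Finset α) (B : Finset β) (F : β → Finset α) :
    ∑ x ∈ U, (B.filter fun b => x ∈ F b).card = ∑ b ∈ B, (U ∩ F b).card := by
  have h := sum_card_bipartiteAbove_eq_sum_card_bipartiteBelow (s := U) (t := B)
    (fun x b => x ∈ F b)
  simp only [bipartiteAbove, bipartiteBelow] at h
  rw [h]
  refine sum_congr rfl fun b _ => ?_
  congr 1

theorem exists_popular_subset {α β : Type*} (U : Finset α) (B : Finset β) (F : β → Finset α)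
    {m E : ℕ} (hm : 0 < m) (hE : 0 < E) (hU : 2 * m * E ≤ U.card)
    (h : U.card * B.card ≤ E * ∑ b ∈ B, (U ∩ F b).card) :
    ∃ X ⊆ U, X.card = m ∧
      B.card ≤ 2 * E * 2 ^ (2 * m * E) * (B.filter fun b => X ⊆ F b).card := by
  obtain ⟨U₀, hsub, hcard, havg⟩ :=
    exists_subset_average (fun x => (B.filter fun b => x ∈ F b).card) U hU
  rw [sum_card_filter_mem, sum_card_filter_mem] at havg
  have hUpos : 0 < U.card := lt_of_lt_of_le (by positivity) hU
  have h1 : 2 * m * E * B.card ≤ E * ∑ b ∈ B, (U₀ ∩ F b).card := by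
    refine Nat.le_of_mul_le_mul_left ?_ hUpos
    calc U.card * (2 * m * E * B.card) = 2 * m * E * (U.card * B.card) := by ring
      _ ≤ 2 * m * E * (E * ∑ b ∈ B, (U ∩ F b).card) := by gcongr
      _ = E * (2 * m * E * ∑ b ∈ B, (U ∩ F b).card) := by ring
      _ ≤ E * (U.card * ∑ b ∈ B, (U₀ ∩ F b).card) := by gcongr
      _ = _ := by ring
  set B' := B.filter fun b => m ≤ (U₀ ∩ F b).card with hB'
  have h2 : ∑ b ∈ B, (U₀ ∩ F b).card ≤ 2 * m * E * B'.card + m * B.card := by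
    calc ∑ b ∈ B, (U₀ ∩ F b).card
        ≤ ∑ b ∈ B, ((if m ≤ (U₀ ∩ F b).card then 2 * m * E else 0) + m) := by
          refine sum_le_sum fun b _ => ?_
          have := card_le_card (inter_subset_left : U₀ ∩ F b ⊆ U₀)
          split_ifs <;> omega
      _ = _ := by
          rw [sum_add_distrib, ← sum_filter, sum_const, sum_const, smul_eq_mul, smul_eq_mul]
          ring
  have h3 : B.card ≤ 2 * E * B'.card := by
    have hmE : 0 < m * E := by positivity
    refine Nat.le_of_mul_le_mul_left ?_ hmE
    have : 2 * m * E * B.card ≤ E * (2 * m * E * B'.card + m * B.card) :=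
      h1.trans (Nat.mul_le_mul_left _ h2)
    nlinarith
  have hex : ∀ b ∈ B', ∃ X ∈ powersetCard m U₀, X ⊆ F b := by
    intro b hb
    obtain ⟨X, hX, hXc⟩ := exists_subset_card_eq (mem_filter.1 hb).2
    exact ⟨X, mem_powersetCard.2 ⟨hX.trans inter_subset_left, hXc⟩, hX.trans inter_subset_right⟩
  choose! X hX hXF using hex
  have h4 : B'.card ≤ ∑ Y ∈ powersetCard m U₀, (B.filter fun b => Y ⊆ F b).card := by
    rw [card_eq_sum_card_fiberwise hX]
    refine sum_le_sum fun Y _ => card_le_card ?_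
    intro b hb
    obtain ⟨hbB, rfl⟩ := mem_filter.1 hb
    exact mem_filter.2 ⟨(mem_filter.1 hbB).1, hXF b hbB⟩
  obtain ⟨Y, hY, hmaxY⟩ := exists_max_image (powersetCard m U₀)
    (fun Y => (B.filter fun b => Y ⊆ F b).card)
    (powersetCard_nonempty.2 (by rw [hcard]; nlinarith))
  have h5 : B'.card ≤ 2 ^ (2 * m * E) * (B.filter fun b => Y ⊆ F b).card := by
    refine h4.trans ((sum_le_card_nsmul _ _ _ hmaxY).trans ?_)
    rw [smul_eq_mul]
    refine Nat.mul_le_mul_right _ ?_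
    rw [← hcard, ← card_powerset]
    exact card_le_card fun S hS => mem_powerset.2 (mem_powersetCard.1 hS).1
  obtain ⟨hYsub, hYc⟩ := mem_powersetCard.1 hY
  refine ⟨Y, hYsub.trans hsub, hYc, h3.trans ?_⟩
  calc 2 * E * B'.card ≤ 2 * E * (2 ^ (2 * m * E) * (B.filter fun b => Y ⊆ F b).card) := by gcongr
    _ = _ := by ring

/-- A dense family of triples contains a complete tripartite subfamily, with the last two parts
disjoint and avoiding a small set. -/
theorem exists_complete_tripartite {m E : ℕ} (hm : 0 < m) (hE : 0 < E) :
    ∃ N : ℕ, ∀ {α : Type} (U W₀ D : Finset α) (O : Finset (α × α)) (F : α × α → Finset α),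
      O ⊆ W₀ ×ˢ W₀ → D.card ≤ 2 * m → 4 * m * E ≤ U.card → N ≤ W₀.card →
      U.card * W₀.card ^ 2 ≤ E * ∑ p ∈ O, (U ∩ F p).card →
      ∃ X ⊆ U, ∃ W₁ ⊆ W₀ \ D, ∃ W₂ ⊆ W₀ \ D, X.card = m ∧ W₁.card = m ∧ W₂.card = m ∧
        Disjoint W₁ W₂ ∧ ∀ i ∈ W₁, ∀ j ∈ W₂, (i, j) ∈ O ∧ X ⊆ F (i, j) := by
  set K₁ := 2 * (2 * E) * 2 ^ (2 * m * (2 * E)) with hK₁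
  set K₂ := 2 * K₁ * 2 ^ (2 * m * K₁) with hK₂
  have hK₁0 : 0 < K₁ := by positivity
  have hK₂0 : 0 < K₂ := by positivity
  refine ⟨2 * m + 2 * m * K₂ + 2 * m * K₁ + 8 * m * E, ?_⟩
  intro α U W₀ D O F hO hD hU hN hsum
  set W := W₀ \ D with hW
  have hWle : W.card ≤ W₀.card := card_le_card sdiff_subset
  have hWc : 2 * m * K₂ + 2 * m * K₁ ≤ W.card := by
    have : W₀.card ≤ W.card + D.card := card_le_card_sdiff_add_card
    omega
  set O' := O.filter fun p => p ∈ W ×ˢ W with hO'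
  have hO'sum : ∑ p ∈ O, (U ∩ F p).card ≤
      ∑ p ∈ O', (U ∩ F p).card + 4 * m * W₀.card * U.card := by
    rw [← sum_filter_add_sum_filter_not O (fun p => p ∈ W ×ˢ W)]
    refine Nat.add_le_add_left ?_ _
    refine (sum_le_card_nsmul _ _ U.card fun p _ => card_le_card inter_subset_left).trans ?_
    rw [smul_eq_mul]
    refine Nat.mul_le_mul_right _ ?_
    have hsub : (O.filter fun p => ¬ p ∈ W ×ˢ W) ⊆ D ×ˢ W₀ ∪ W₀ ×ˢ D := by
      rintro ⟨i, j⟩ hp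
      obtain ⟨hp1, hp2⟩ := mem_filter.1 hp
      have := hO hp1
      simp only [mem_product, hW, mem_sdiff, mem_union] at this hp2 ⊢
      tauto
    refine (card_le_card hsub).trans ((card_union_le _ _).trans ?_)
    rw [card_product, card_product]
    nlinarith
  have hsum' : U.card * (W ×ˢ W).card ≤
      2 * E * ∑ p ∈ W ×ˢ W, (U ∩ (if p ∈ O then F p else ∅)).card := by
    have h1 : ∑ p ∈ W ×ˢ W, (U ∩ (if p ∈ O then F p else ∅)).card =
        ∑ p ∈ O', (U ∩ F p).card := by
      have : O' = (W ×ˢ W).filter fun p => p ∈ O := by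
        ext p; simp only [hO', mem_filter]; tauto
      rw [this, sum_filter]
      refine sum_congr rfl fun p _ => ?_
      split_ifs <;> simp
    rw [h1, card_product]
    have h2 : U.card * (W.card * W.card) ≤ U.card * W₀.card ^ 2 := by
      rw [sq]; gcongr
    have h3 : 8 * m * E ≤ W₀.card := by omega
    have h4 : 8 * m * E * (W₀.card * U.card) ≤ W₀.card * (W₀.card * U.card) := by gcongr
    have h5 : E * ∑ p ∈ O, (U ∩ F p).card ≤
      E * (∑ p ∈ O', (U ∩ F p).card + 4 * m * W₀.card * U.card) := by gcongr
    nlinarith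
  obtain ⟨X, hXU, hXc, hX⟩ := exists_popular_subset U (W ×ˢ W) _ hm
    (by positivity : 0 < 2 * E) (by linarith) hsum'
  set P := (W ×ˢ W).filter fun p => X ⊆ (if p ∈ O then F p else ∅) with hP
  have hPO : ∀ p ∈ P, p ∈ O ∧ X ⊆ F p := by
    intro p hp
    have h := (mem_filter.1 hp).2
    split_ifs at h with hpO
    · exact ⟨hpO, h⟩
    · rw [subset_empty.1 h] at hXc
      simp at hXc
      omega
  have hPsum : W.card * W.card ≤
      K₁ * ∑ j ∈ W, (W ∩ (W.filter fun i => (i, j) ∈ P)).card := by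
    rw [card_product] at hX
    refine hX.trans (Nat.mul_le_mul_left _ (le_of_eq ?_))
    have : P = (W ×ˢ W).filter fun p => p ∈ P := by
      ext p; simp only [mem_filter]; exact ⟨fun h => ⟨(mem_filter.1 h).1, h⟩, fun h => h.2⟩
    rw [this, card_filter, sum_product_right]
    refine sum_congr rfl fun j _ => ?_
    rw [inter_eq_right.2 (filter_subset _ _), card_filter]
    refine sum_congr rfl fun i _ => ?_
    rw [← this]
  obtain ⟨W₁, hW₁, hW₁c, hJ⟩ := exists_popular_subset W W _ hm hK₁0
    ((Nat.le_add_left _ _).trans hWc) hPsum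
  set J := W.filter fun j => W₁ ⊆ W.filter fun i => (i, j) ∈ P with hJdef
  have hJc : m ≤ (J \ W₁).card := by
    have h1 : 2 * m ≤ J.card := by
      refine Nat.le_of_mul_le_mul_left ?_ hK₂0
      calc K₂ * (2 * m) ≤ W.card := by linarith [Nat.zero_le (2 * m * K₁)]
        _ ≤ K₂ * J.card := hJ
    have := card_le_card_sdiff_add_card (s := J) (t := W₁)
    omega
  obtain ⟨W₂, hW₂, hW₂c⟩ := exists_subset_card_eq hJc
  refine ⟨X, hXU, W₁, hW₁, W₂, fun j hj => (mem_filter.1 (mem_sdiff.1 (hW₂ hj)).1).1, hXc, hW₁c,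
    hW₂c, ?_, ?_⟩
  · rw [disjoint_left]
    exact fun i hi hi2 => (mem_sdiff.1 (hW₂ hi2)).2 hi
  · intro i hi j hj
    have h1 := (mem_filter.1 (mem_sdiff.1 (hW₂ hj)).1).2 hi
    exact hPO _ (mem_filter.1 h1).2

theorem card_mul_pred_le_two_mul_sum {n : ℕ} (R : Finset (Fin n)) :
    R.card * (R.card - 1) ≤ 2 * ∑ v ∈ R, (v : ℕ) := by
  induction R using Finset.induction_on_max with
  | empty => simp
  | insert a s ha ih =>
    have hna : a ∉ s := fun h => lt_irrefl _ (ha a h)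
    rw [sum_insert hna, card_insert_of_notMem hna]
    have hle : s.card ≤ (a : ℕ) := by
      have : s ⊆ Iio a := fun v hv => mem_Iio.2 (ha v hv)
      simpa using card_le_card this
    rcases Nat.eq_zero_or_pos s.card with h | h
    · simp [h]
    · obtain ⟨k, hk⟩ : ∃ k, s.card = k + 1 := ⟨s.card - 1, by omega⟩
      simp only [hk, Nat.add_sub_cancel] at *
      nlinarith

/-- `X, Y, Z` are the parts of a complete tripartite subgraph with parts of size `m`. -/
def IsBlock {n : ℕ} (H : Finset (Finset (Fin n))) (m : ℕ) (X Y Z : Finset (Fin n)) : Prop :=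
  X.card = m ∧ Y.card = m ∧ Z.card = m ∧ ∀ x ∈ X, ∀ y ∈ Y, ∀ z ∈ Z, Edge H x y z

/-- `S` is partitioned into complete tripartite blocks with parts of size `m`. -/
def Tiled {n : ℕ} (H : Finset (Finset (Fin n))) (m : ℕ) (S : Finset (Fin n)) : Prop :=
  ∃ 𝓤 : Finset (Finset (Fin n)), (∀ B ∈ 𝓤, ∃ X Y Z, IsBlock H m X Y Z ∧ B = X ∪ Y ∪ Z) ∧
    (𝓤 : Set (Finset (Fin n))).PairwiseDisjoint id ∧ 𝓤.biUnion id = S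

section Blocks

variable {n m : ℕ} {H : Finset (Finset (Fin n))} {X Y Z S T : Finset (Fin n)}

theorem IsBlock.rot (h : IsBlock H m X Y Z) : IsBlock H m Y Z X :=
  ⟨h.2.1, h.2.2.1, h.1, fun y hy z hz x hx => (h.2.2.2 x hx y hy z hz).rot⟩

theorem IsBlock.sub (h : IsBlock H m X Y Z) {k : ℕ} {X' Y' Z' : Finset (Fin n)} (hX : X' ⊆ X)
    (hY : Y' ⊆ Y) (hZ : Z' ⊆ Z) (hXc : X'.card = k) (hYc : Y'.card = k) (hZc : Z'.card = k) :
    IsBlock H k X' Y' Z' :=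
  ⟨hXc, hYc, hZc, fun x hx y hy z hz => h.2.2.2 x (hX hx) y (hY hy) z (hZ hz)⟩

theorem IsBlock.disjoint (h3 : Is3Graph n H) (hm : 0 < m) (h : IsBlock H m X Y Z) :
    Disjoint X Y ∧ Disjoint Y Z ∧ Disjoint X Z := by
  obtain ⟨x0, hx0⟩ := card_pos.1 (h.1 ▸ hm)
  obtain ⟨y0, hy0⟩ := card_pos.1 (h.2.1 ▸ hm)
  obtain ⟨z0, hz0⟩ := card_pos.1 (h.2.2.1 ▸ hm)
  refine ⟨?_, ?_, ?_⟩ <;> rw [disjoint_left]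
  · exact fun a ha ha' => (Edge.ne h3 (h.2.2.2 a ha a ha' z0 hz0)).1 rfl
  · exact fun a ha ha' => (Edge.ne h3 (h.2.2.2 x0 hx0 a ha a ha')).2.1 rfl
  · exact fun a ha ha' => (Edge.ne h3 (h.2.2.2 a ha y0 hy0 a ha')).2.2 rfl

theorem IsBlock.card_union (h3 : Is3Graph n H) (hm : 0 < m) (h : IsBlock H m X Y Z) :
    (X ∪ Y ∪ Z).card = 3 * m := by
  obtain ⟨h1, h2, h4⟩ := h.disjoint h3 hm
  rw [card_union_of_disjoint (disjoint_union_left.2 ⟨h4, h2⟩), card_union_of_disjoint h1, h.1,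
    h.2.1, h.2.2.1]
  ring

theorem IsBlock.tiled (h : IsBlock H m X Y Z) : Tiled H m (X ∪ Y ∪ Z) :=
  ⟨{X ∪ Y ∪ Z}, by simpa using ⟨X, Y, Z, h, rfl⟩, by simp, by simp⟩

theorem Tiled.empty : Tiled H m ∅ := ⟨∅, by simp, by simp, by simp⟩

theorem Tiled.union (hS : Tiled H m S) (hT : Tiled H m T) (h : Disjoint S T) :
    Tiled H m (S ∪ T) := by
  obtain ⟨𝓤, h1, h2, rfl⟩ := hS
  obtain ⟨𝓥, h3, h4, rfl⟩ := hT
  refine ⟨𝓤 ∪ 𝓥, ?_, ?_, by rw [union_biUnion]⟩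
  · intro B hB
    rcases mem_union.1 hB with hB | hB
    · exact h1 B hB
    · exact h3 B hB
  · have hd : ∀ B ∈ 𝓤, ∀ B' ∈ 𝓥, Disjoint B B' := fun B hB B' hB' =>
      h.mono (subset_biUnion_of_mem id hB) (subset_biUnion_of_mem id hB')
    intro B hB B' hB' hne
    simp only [coe_union, Set.mem_union, mem_coe] at hB hB'
    rcases hB with hB | hB <;> rcases hB' with hB' | hB'
    · exact h2 hB hB' hne
    · exact hd B hB B' hB'
    · exact (hd B' hB' B hB).symm
    · exact h4 hB hB' hne

theorem IsBlock.split (h3 : Is3Graph n H) (hm : 0 < m) :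
    ∀ {C : ℕ} {X Y Z : Finset (Fin n)}, IsBlock H (C * m) X Y Z → Tiled H m (X ∪ Y ∪ Z)
  | 0, X, Y, Z, h => by
      have h1 := h.1
      have h2 := h.2.1
      have h4 := h.2.2.1
      rw [zero_mul, card_eq_zero] at h1 h2 h4
      subst h1 h2 h4
      simpa using Tiled.empty
  | C + 1, X, Y, Z, h => by
      have hle : m ≤ (C + 1) * m := Nat.le_mul_of_pos_left _ (by omega)
      obtain ⟨X', hX, hXc⟩ := exists_subset_card_eq (hle.trans h.1.ge)
      obtain ⟨Y', hY, hYc⟩ := exists_subset_card_eq (hle.trans h.2.1.ge)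
      obtain ⟨Z', hZ, hZc⟩ := exists_subset_card_eq (hle.trans h.2.2.1.ge)
      have hc : ∀ {A A' : Finset (Fin n)}, A' ⊆ A → A.card = (C + 1) * m → A'.card = m →
          (A \ A').card = C * m := by
        intro A A' hs h1 h2
        rw [card_sdiff_of_subset hs, h1, h2, add_mul, one_mul, Nat.add_sub_cancel]
      have h1 := (h.sub hX hY hZ hXc hYc hZc).tiled
      have h2 := IsBlock.split h3 hm (h.sub (sdiff_subset (t := X')) (sdiff_subset (t := Y'))
        (sdiff_subset (t := Z')) (hc hX h.1 hXc) (hc hY h.2.1 hYc) (hc hZ h.2.2.1 hZc))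
      obtain ⟨d1, d2, d3⟩ := h.disjoint h3 (lt_of_lt_of_le hm hle)
      rw [disjoint_left] at d1 d2 d3
      have hd : Disjoint (X' ∪ Y' ∪ Z') (X \ X' ∪ Y \ Y' ∪ Z \ Z') := by
        rw [disjoint_left]
        intro a
        have := @hX a
        have := @hY a
        have := @hZ a
        have := @d1 a
        have := @d2 a
        have := @d3 a
        simp only [mem_union, mem_sdiff]
        tauto
      have h5 := h1.union h2 hd
      convert h5 using 1
      ext a
      have := @hX a
      have := @hY a
      have := @hZ a
      simp only [mem_union, mem_sdiff]
      tauto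

theorem Tiled.split (h3 : Is3Graph n H) (hm : 0 < m) {C : ℕ} (h : Tiled H (C * m) S) :
    Tiled H m S := by
  obtain ⟨𝓤, h1, h2, rfl⟩ := h
  induction 𝓤 using Finset.induction_on with
  | empty => simpa using Tiled.empty
  | insert B 𝓤 hB ih =>
    rw [biUnion_insert]
    obtain ⟨X, Y, Z, hblock, hB'⟩ := h1 B (mem_insert_self _ _)
    have hB2 : Tiled H m B := hB' ▸ hblock.split h3 hm
    refine hB2.union (ih (fun B' hB' => h1 B' (mem_insert_of_mem hB')) (h2.subset (by simp))) ?_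
    rw [disjoint_biUnion_right]
    intro B' hB'
    exact h2 (by simp) (by simp [hB']) (by rintro rfl; exact hB hB')

end Blocks

/-- The weight of a set of vertices: vertices of small label are heavier. -/
def wt {n : ℕ} (S : Finset (Fin n)) : ℝ := ∑ v ∈ S, (2 * (n : ℝ) - (v : ℕ))

theorem wt_union {n : ℕ} {S T : Finset (Fin n)} (h : Disjoint S T) :
    wt (S ∪ T) = wt S + wt T := sum_union h

theorem wt_sdiff {n : ℕ} {S T : Finset (Fin n)} (h : T ⊆ S) : wt (S \ T) + wt T = wt S :=
  sum_sdiff h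

theorem le_wt {n : ℕ} (S : Finset (Fin n)) : n * (S.card : ℝ) ≤ wt S := by
  rw [mul_comm, ← nsmul_eq_mul]
  refine card_nsmul_le_sum _ _ _ fun v _ => ?_
  have : ((v : ℕ) : ℝ) ≤ n := by exact_mod_cast v.2.le
  linarith

theorem wt_le {n : ℕ} (S : Finset (Fin n)) : wt S ≤ 2 * n * (S.card : ℝ) := by
  rw [mul_comm, ← nsmul_eq_mul]
  refine sum_le_card_nsmul _ _ _ fun v _ => ?_
  have : (0 : ℝ) ≤ ((v : ℕ) : ℝ) := by positivity
  linarith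

theorem wt_eq {n : ℕ} (S : Finset (Fin n)) :
    wt S = 2 * n * (S.card : ℝ) - ∑ v ∈ S, ((v : ℕ) : ℝ) := by
  rw [wt, sum_sub_distrib, sum_const, nsmul_eq_mul]
  ring

/-- A dense family of triples of a 3-graph contains a block, with parameters `m`, `E`. -/
def FindsBlocks (N m E : ℕ) : Prop :=
  ∀ {n : ℕ} (H : Finset (Finset (Fin n))) (U W₀ D : Finset (Fin n)) (O : Finset (Fin n × Fin n)),
    O ⊆ W₀ ×ˢ W₀ → D.card ≤ 2 * m → 4 * m * E ≤ U.card → N ≤ W₀.card →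
    U.card * W₀.card ^ 2 ≤ E * ∑ p ∈ O, (U ∩ nbr H p.1 p.2).card →
    ∃ X ⊆ U, ∃ W₁ ⊆ W₀ \ D, ∃ W₂ ⊆ W₀ \ D, IsBlock H m X W₁ W₂ ∧ Disjoint W₁ W₂ ∧
      ∀ i ∈ W₁, ∀ j ∈ W₂, (i, j) ∈ O

theorem exists_findsBlocks {m E : ℕ} (hm : 0 < m) (hE : 0 < E) : ∃ N, FindsBlocks N m E := by
  obtain ⟨N, hN⟩ := exists_complete_tripartite hm hE
  refine ⟨N, fun H U W₀ D O hO hD hU hW hs => ?_⟩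
  obtain ⟨X, hX, W₁, h1, W₂, h2, c0, c1, c2, hd, h⟩ :=
    hN U W₀ D O (fun p => nbr H p.1 p.2) hO hD hU hW (by convert hs)
  refine ⟨X, hX, W₁, by convert h1, W₂, by convert h2, ⟨c0, c1, c2, fun x hx i hi j hj => ?_⟩, hd,
    fun i hi j hj => (h i hi j hj).1⟩
  exact (mem_nbr.1 ((h i hi j hj).2 hx)).rot.rot

section Improve

variable {n m E N : ℕ} {H : Finset (Finset (Fin n))} {X Y Z W₀ : Finset (Fin n)}
  {O : Finset (Fin n × Fin n)}

theorem improve_two (h3 : Is3Graph n H) (hm : 0 < m) (hE : 0 < E) (hN : FindsBlocks N m E)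
    (hB : IsBlock H (4 * E * m) X Y Z) (hd : Disjoint (X ∪ Y ∪ Z) W₀) (hO : O ⊆ W₀ ×ˢ W₀)
    (hW : N ≤ W₀.card)
    (hX : X.card * W₀.card ^ 2 ≤ E * ∑ p ∈ O, (X ∩ nbr H p.1 p.2).card)
    (hY : Y.card * W₀.card ^ 2 ≤ E * ∑ p ∈ O, (Y ∩ nbr H p.1 p.2).card) :
    ∃ T, Tiled H m T ∧ T ⊆ X ∪ Y ∪ Z ∪ W₀ ∧ T.card ≤ 6 * (4 * E * m) ∧
      wt (X ∪ Y ∪ Z) + 2 * n * m ≤ wt T := by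
  have hmM : m ≤ 4 * E * m := Nat.le_mul_of_pos_left _ (by omega)
  obtain ⟨dXY, dYZ, dXZ⟩ := hB.disjoint h3 (by positivity)
  obtain ⟨X', hX', W₁, hW₁, W₂, hW₂, b1, d12, -⟩ :=
    hN H X W₀ ∅ O hO (by simp) (by rw [hB.1]; linarith) hW hX
  obtain ⟨Y', hY', W₃, hW₃, W₄, hW₄, b2, d34, -⟩ :=
    hN H Y W₀ (W₁ ∪ W₂) O hO
      ((card_union_le _ _).trans (by rw [b1.2.1, b1.2.2.1]; omega))
      (by rw [hB.2.1]; linarith) hW hY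
  obtain ⟨Z₀, hZ₀, hZ₀c⟩ := exists_subset_card_eq (s := Z) (n := 4 * E * m - m)
    (by rw [hB.2.2.1]; omega)
  have b3 : IsBlock H ((4 * E - 1) * m) (X \ X') (Y \ Y') Z₀ := by
    refine hB.sub sdiff_subset sdiff_subset hZ₀ ?_ ?_ ?_
    · rw [card_sdiff_of_subset hX', hB.1, b1.1, Nat.sub_mul, one_mul]
    · rw [card_sdiff_of_subset hY', hB.2.1, b2.1, Nat.sub_mul, one_mul]
    · rw [hZ₀c, Nat.sub_mul, one_mul]
  have hXm := @hX'
  have hYm := @hY'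
  have hZm := @hZ₀
  rw [disjoint_left] at hd dXY dYZ dXZ d12 d34
  simp only [subset_iff, mem_sdiff, mem_union, notMem_empty, not_false_eq_true, and_true]
    at hW₁ hW₂ hW₃ hW₄ hXm hYm hZm hd
  have d1 : Disjoint (X' ∪ W₁ ∪ W₂) (Y' ∪ W₃ ∪ W₄) := by
    rw [disjoint_left]; intro a; simp only [mem_union]
    grind
  have d2 : Disjoint (X' ∪ W₁ ∪ W₂ ∪ (Y' ∪ W₃ ∪ W₄)) (X \ X' ∪ Y \ Y' ∪ Z₀) := by
    rw [disjoint_left]; intro a; simp only [mem_union, mem_sdiff]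
    grind
  refine ⟨X' ∪ W₁ ∪ W₂ ∪ (Y' ∪ W₃ ∪ W₄) ∪ (X \ X' ∪ Y \ Y' ∪ Z₀),
    (b1.tiled.union b2.tiled d1).union (b3.split h3 hm) d2, ?_, ?_, ?_⟩
  · intro a; simp only [mem_union, mem_sdiff]; grind
  · rw [card_union_of_disjoint d2, card_union_of_disjoint d1]
    have := b1.card_union h3 hm
    have := b2.card_union h3 hm
    have h9 : (X \ X' ∪ Y \ Y' ∪ Z₀).card ≤ 3 * ((4 * E - 1) * m) := by
      refine (card_union_le _ _).trans ((Nat.add_le_add_right (card_union_le _ _) _).trans ?_)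
      rw [b3.1, b3.2.1, b3.2.2.1]; omega
    rw [Nat.sub_mul, one_mul] at h9
    omega
  · have e1 : Disjoint (X' ∪ W₁) W₂ := by
      rw [disjoint_left]; intro a; simp only [mem_union]; grind
    have e2 : Disjoint X' W₁ := by
      rw [disjoint_left]; intro a; grind
    have e3 : Disjoint (Y' ∪ W₃) W₄ := by
      rw [disjoint_left]; intro a; simp only [mem_union]; grind
    have e4 : Disjoint Y' W₃ := by
      rw [disjoint_left]; intro a; grind
    have e5 : Disjoint (X \ X' ∪ Y \ Y') Z₀ := by
      rw [disjoint_left]; intro a; simp only [mem_union, mem_sdiff]; grind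
    have e6 : Disjoint (X \ X') (Y \ Y') := by
      rw [disjoint_left]; intro a; simp only [mem_sdiff]; grind
    have e7 : Disjoint (X ∪ Y) Z := by
      rw [disjoint_left]; intro a; simp only [mem_union]; grind
    rw [wt_union d2, wt_union d1, wt_union e1, wt_union e2, wt_union e3, wt_union e4, wt_union e5,
      wt_union e6, wt_union e7, wt_union (disjoint_left.2 dXY)]
    have f1 := wt_sdiff hX'
    have f2 := wt_sdiff hY'
    have f3 := wt_sdiff hZ₀
    have f4 := wt_le (Z \ Z₀)
    have f5 : (Z \ Z₀).card = m := by
      rw [card_sdiff_of_subset hZ₀, hZ₀c, hB.2.2.1]; omega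
    have g1 := le_wt W₁
    have g2 := le_wt W₂
    have g3 := le_wt W₃
    have g4 := le_wt W₄
    rw [b1.2.1] at g1
    rw [b1.2.2.1] at g2
    rw [b2.2.1] at g3
    rw [b2.2.2.1] at g4
    rw [f5] at f4
    linarith

theorem improve_one (h3 : Is3Graph n H) (hm : 0 < m) (hE : 0 < E) (hN : FindsBlocks N m E)
    (hB : IsBlock H (4 * E * m) X Y Z) (hd : Disjoint (X ∪ Y ∪ Z) W₀) (hO : O ⊆ W₀ ×ˢ W₀)
    (hW : N ≤ W₀.card) {t : ℝ} (hOt : ∀ p ∈ O, ((4 * E * m : ℕ) : ℝ) * ((p.1 : ℕ) + (p.2 : ℕ) + t) ≤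
      ∑ v ∈ Y, ((v : ℕ) : ℝ) + ∑ v ∈ Z, ((v : ℕ) : ℝ))
    (hX : X.card * W₀.card ^ 2 ≤ E * ∑ p ∈ O, (X ∩ nbr H p.1 p.2).card) :
    ∃ T, Tiled H m T ∧ T ⊆ X ∪ Y ∪ Z ∪ W₀ ∧ T.card ≤ 6 * (4 * E * m) ∧
      wt (X ∪ Y ∪ Z) + t * m ≤ wt T := by
  have hmM : m ≤ 4 * E * m := Nat.le_mul_of_pos_left _ (by omega)
  obtain ⟨dXY, dYZ, dXZ⟩ := hB.disjoint h3 (by positivity)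
  obtain ⟨X', hX', W₁, hW₁, W₂, hW₂, b1, d12, hW₁₂⟩ :=
    hN H X W₀ ∅ O hO (by simp) (by rw [hB.1]; linarith) hW hX
  obtain ⟨Y', hY', hY'c, hYa⟩ := exists_subset_average (fun v : Fin n => (v : ℕ)) Y
    (hmM.trans hB.2.1.ge)
  obtain ⟨Z', hZ', hZ'c, hZa⟩ := exists_subset_average (fun v : Fin n => (v : ℕ)) Z
    (hmM.trans hB.2.2.1.ge)
  have b3 : IsBlock H ((4 * E - 1) * m) (X \ X') (Y \ Y') (Z \ Z') := by
    refine hB.sub sdiff_subset sdiff_subset sdiff_subset ?_ ?_ ?_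
    · rw [card_sdiff_of_subset hX', hB.1, b1.1, Nat.sub_mul, one_mul]
    · rw [card_sdiff_of_subset hY', hB.2.1, hY'c, Nat.sub_mul, one_mul]
    · rw [card_sdiff_of_subset hZ', hB.2.2.1, hZ'c, Nat.sub_mul, one_mul]
  have hXm := @hX'
  rw [disjoint_left] at hd dXY dYZ dXZ d12
  simp only [subset_iff, mem_sdiff, mem_union, notMem_empty, not_false_eq_true, and_true]
    at hW₁ hW₂ hXm hd
  have d2 : Disjoint (X' ∪ W₁ ∪ W₂) (X \ X' ∪ Y \ Y' ∪ Z \ Z') := by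
    rw [disjoint_left]; intro a; simp only [mem_union, mem_sdiff]
    grind
  refine ⟨X' ∪ W₁ ∪ W₂ ∪ (X \ X' ∪ Y \ Y' ∪ Z \ Z'), b1.tiled.union (b3.split h3 hm) d2, ?_, ?_, ?_⟩
  · intro a; simp only [mem_union, mem_sdiff]; grind
  · rw [card_union_of_disjoint d2]
    have := b1.card_union h3 hm
    have h9 : (X \ X' ∪ Y \ Y' ∪ Z \ Z').card ≤ 3 * ((4 * E - 1) * m) := by
      refine (card_union_le _ _).trans ((Nat.add_le_add_right (card_union_le _ _) _).trans ?_)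
      rw [b3.1, b3.2.1, b3.2.2.1]; omega
    rw [Nat.sub_mul, one_mul] at h9
    omega
  · have e1 : Disjoint (X' ∪ W₁) W₂ := by
      rw [disjoint_left]; intro a; simp only [mem_union]; grind
    have e2 : Disjoint X' W₁ := by
      rw [disjoint_left]; intro a; grind
    have e5 : Disjoint (X \ X' ∪ Y \ Y') (Z \ Z') := by
      rw [disjoint_left]; intro a; simp only [mem_union, mem_sdiff]; grind
    have e6 : Disjoint (X \ X') (Y \ Y') := by
      rw [disjoint_left]; intro a; simp only [mem_sdiff]; grind
    have e7 : Disjoint (X ∪ Y) Z := by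
      rw [disjoint_left]; intro a; simp only [mem_union]; grind
    rw [wt_union d2, wt_union e1, wt_union e2, wt_union e5,
      wt_union e6, wt_union e7, wt_union (disjoint_left.2 dXY)]
    have f1 := wt_sdiff hX'
    have f2 := wt_sdiff hY'
    have f3 := wt_sdiff hZ'
    have g1 := wt_eq W₁
    have g2 := wt_eq W₂
    have g3 := wt_eq Y'
    have g4 := wt_eq Z'
    rw [b1.2.1] at g1
    rw [b1.2.2.1] at g2
    rw [hY'c] at g3
    rw [hZ'c] at g4
    rw [hB.2.1] at hYa
    rw [hB.2.2.1] at hZa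
    have hYa' : (m : ℝ) * ∑ v ∈ Y, ((v : ℕ) : ℝ) ≤
      ((4 * E * m : ℕ) : ℝ) * ∑ v ∈ Y', ((v : ℕ) : ℝ) := by exact_mod_cast hYa
    have hZa' : (m : ℝ) * ∑ v ∈ Z, ((v : ℕ) : ℝ) ≤
      ((4 * E * m : ℕ) : ℝ) * ∑ v ∈ Z', ((v : ℕ) : ℝ) := by exact_mod_cast hZa
    have hMpos : (0 : ℝ) < ((4 * E * m : ℕ) : ℝ) := by
      have : 0 < 4 * E * m := by positivity
      exact_mod_cast this
    generalize ((4 * E * m : ℕ) : ℝ) = M at *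
    have hm' : (0 : ℝ) < m := by exact_mod_cast hm
    have hsum : ∑ i ∈ W₁, ∑ j ∈ W₂, M * (((i : ℕ) : ℝ) + ((j : ℕ) : ℝ) + t) ≤
        ∑ i ∈ W₁, ∑ j ∈ W₂, (∑ v ∈ Y, ((v : ℕ) : ℝ) + ∑ v ∈ Z, ((v : ℕ) : ℝ)) :=
      sum_le_sum fun i hi => sum_le_sum fun j hj => hOt _ (hW₁₂ i hi j hj)
    simp only [← mul_sum, sum_add_distrib, sum_const, nsmul_eq_mul, b1.2.1, b1.2.2.1] at hsum
    have key : M * m * (∑ v ∈ W₁, ((v : ℕ) : ℝ) + ∑ v ∈ W₂, ((v : ℕ) : ℝ) + m * t) ≤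
        M * m * (∑ v ∈ Y', ((v : ℕ) : ℝ) + ∑ v ∈ Z', ((v : ℕ) : ℝ)) := by
      nlinarith
    have key' := le_of_mul_le_mul_left key (by positivity)
    linarith

end Improve

theorem label_count {n M : ℕ} (hM : 0 < M) (𝓕 : Finset (Finset (Fin n)))
    (hd : (𝓕 : Set (Finset (Fin n))).PairwiseDisjoint id) (f : Finset (Fin n) → Finset (Fin n))
    (hf : ∀ B ∈ 𝓕, f B ⊆ B) (hc : ∀ B ∈ 𝓕, (f B).card = 2 * M) {t : ℝ} (ht : 0 ≤ t)
    (hs : ∀ B ∈ 𝓕, ∑ v ∈ f B, ((v : ℕ) : ℝ) ≤ M * t) : (M : ℝ) * 𝓕.card ≤ (t + 1) / 2 := by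
  have hd' : (𝓕 : Set (Finset (Fin n))).PairwiseDisjoint f := fun A hA B hB h =>
    (hd hA hB h).mono (hf A hA) (hf B hB)
  have h1 := card_mul_pred_le_two_mul_sum (𝓕.biUnion f)
  rw [card_biUnion hd', sum_congr rfl hc, sum_const, smul_eq_mul, sum_biUnion hd'] at h1
  rcases Nat.eq_zero_or_pos 𝓕.card with h0 | h0
  · rw [h0]; simp only [Nat.cast_zero, mul_zero]; linarith
  · have h2 : ((∑ B ∈ 𝓕, ∑ v ∈ f B, (v : ℕ) : ℕ) : ℝ) ≤ 𝓕.card * (M * t) := by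
      push_cast
      rw [← nsmul_eq_mul]
      exact sum_le_card_nsmul _ _ _ hs
    have h3 : 1 ≤ 𝓕.card * (2 * M) := Nat.mul_pos h0 (by omega)
    have h4 : ((𝓕.card * (2 * M) : ℕ) : ℝ) * ((𝓕.card * (2 * M) : ℕ) - 1) ≤
        2 * (∑ B ∈ 𝓕, ∑ v ∈ f B, (v : ℕ) : ℕ) := by
      have : ((𝓕.card * (2 * M) - 1 : ℕ) : ℝ) = ((𝓕.card * (2 * M) : ℕ) : ℝ) - 1 := by
        push_cast [h3]; rfl
      rw [← this]
      exact_mod_cast h1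
    push_cast at h4
    have hp : (0 : ℝ) < 𝓕.card * M := by exact_mod_cast Nat.mul_pos h0 hM
    have h5 : (𝓕.card * M : ℝ) * (2 * (2 * (M * 𝓕.card) - 1)) ≤ (𝓕.card * M : ℝ) * (2 * t) := by
      push_cast at h2
      nlinarith
    have := le_of_mul_le_mul_left h5 hp
    linarith

theorem not_sparse {γ : ℝ} {n M E : ℕ} {H : Finset (Finset (Fin n))} (hγ : 0 < γ) (hM : 0 < M)
    (hE : 16 ≤ γ * E) (hn : 1 < γ * n) (hH : PosaCond γ n H) (𝓤 : Finset (Finset (Fin n)))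
    (hd : (𝓤 : Set (Finset (Fin n))).PairwiseDisjoint id) (U W₀ R : Finset (Fin n))
    (hU : Disjoint U (𝓤.biUnion id)) (hR : ∀ v, v ∈ R ∨ v ∈ U ∨ v ∈ 𝓤.biUnion id)
    (hRc : R.card ≤ γ / 8 * n) (hW : 2 ≤ W₀.card) (X Y Z : Finset (Fin n) → Finset (Fin n))
    (hB : ∀ B ∈ 𝓤, IsBlock H M (X B) (Y B) (Z B) ∧ B = X B ∪ Y B ∪ Z B)
    (h1 : E * ∑ p ∈ W₀.offDiag, (U ∩ nbr H p.1 p.2).card < U.card * W₀.card ^ 2)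
    (h2 : ∀ B ∈ 𝓤, E * ∑ p ∈ W₀.offDiag, (Y B ∩ nbr H p.1 p.2).card < (Y B).card * W₀.card ^ 2)
    (h3 : ∀ B ∈ 𝓤, E * ∑ p ∈ W₀.offDiag, (Z B ∩ nbr H p.1 p.2).card < (Z B).card * W₀.card ^ 2)
    (h4 : ∀ B ∈ 𝓤, E * ∑ p ∈ W₀.offDiag.filter (fun p : Fin n × Fin n =>
        (M : ℝ) * ((p.1 : ℕ) + (p.2 : ℕ) + γ / 2 * n) ≤
          ∑ v ∈ Y B, ((v : ℕ) : ℝ) + ∑ v ∈ Z B, ((v : ℕ) : ℝ)), (X B ∩ nbr H p.1 p.2).card <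
      (X B).card * W₀.card ^ 2) : False := by
  have hE0 : 0 < E := by
    rcases Nat.eq_zero_or_pos E with rfl | h
    · norm_num at hE
    · exact h
  set O := W₀.offDiag with hO
  set w := W₀.card with hw
  obtain ⟨P, hP, hX'⟩ : ∃ P : Finset (Fin n) → Fin n × Fin n → Prop,
      (∀ B p, ¬ P B p → ∑ v ∈ Y B, ((v : ℕ) : ℝ) + ∑ v ∈ Z B, ((v : ℕ) : ℝ) ≤
        (M : ℝ) * ((p.1 : ℕ) + (p.2 : ℕ) + γ / 2 * n)) ∧
      ∀ B ∈ 𝓤, E * ∑ p ∈ O.filter (P B), (X B ∩ nbr H p.1 p.2).card ≤ M * w ^ 2 := by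
    refine ⟨_, fun B p h => (not_le.1 h).le, fun B h => ?_⟩
    have := (h4 B h).le
    rwa [(hB B h).1.1] at this
  clear_value O w
  clear h4
  -- total size
  have hcardB : ∀ B ∈ 𝓤, B.card = 3 * M := fun B h => by
    conv_lhs => rw [(hB B h).2]
    exact (hB B h).1.card_union hH.three hM
  have htot : U.card + 3 * M * 𝓤.card ≤ n := by
    have h5 : (U ∪ 𝓤.biUnion id).card ≤ n := by simpa using card_le_univ (U ∪ 𝓤.biUnion id)
    rw [card_union_of_disjoint hU, card_biUnion hd,
      sum_congr (f := fun B : Finset (Fin n) => (id B).card) rfl hcardB, sum_const,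
      smul_eq_mul] at h5
    linarith
  -- pointwise upper bound on neighbourhoods
  have hpt : ∀ p ∈ O, (nbr H p.1 p.2).card ≤ R.card + (U ∩ nbr H p.1 p.2).card +
      ∑ B ∈ 𝓤, ((X B ∩ nbr H p.1 p.2).card + (Y B ∩ nbr H p.1 p.2).card +
        (Z B ∩ nbr H p.1 p.2).card) := by
    intro p _
    have hsub : nbr H p.1 p.2 ⊆ R ∪ U ∩ nbr H p.1 p.2 ∪ 𝓤.biUnion (fun B =>
        X B ∩ nbr H p.1 p.2 ∪ Y B ∩ nbr H p.1 p.2 ∪ Z B ∩ nbr H p.1 p.2) := by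
      intro v hv
      simp only [mem_union, mem_inter, mem_biUnion]
      rcases hR v with h | h | h
      · exact Or.inl (Or.inl h)
      · exact Or.inl (Or.inr ⟨h, hv⟩)
      · obtain ⟨B, hBU, hvB⟩ := mem_biUnion.1 h
        refine Or.inr ⟨B, hBU, ?_⟩
        rw [id, (hB B hBU).2, mem_union, mem_union] at hvB
        tauto
    refine (card_le_card hsub).trans ((card_union_le _ _).trans (Nat.add_le_add
      (card_union_le _ _) (card_biUnion_le.trans (sum_le_sum fun B _ => ?_))))
    exact (card_union_le _ _).trans (Nat.add_le_add_right (card_union_le _ _) _)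
  have hX : ∀ B ∈ 𝓤, E * ∑ p ∈ O, (X B ∩ nbr H p.1 p.2).card ≤
      M * w ^ 2 + E * ∑ p ∈ O, (if P B p then 0 else M) := by
    intro B h
    rw [← sum_filter_add_sum_filter_not O (P B), mul_add]
    refine Nat.add_le_add ?_ (Nat.mul_le_mul_left _ ?_)
    · exact hX' B h
    · rw [sum_filter]
      refine sum_le_sum fun p _ => ?_
      by_cases hp : P B p
      · rw [if_neg (not_not.2 hp), if_pos hp]
      · rw [if_pos hp, if_neg hp]
        exact (card_le_card inter_subset_left).trans (hB B h).1.1.le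
  have hsum : E * ∑ p ∈ O, (nbr H p.1 p.2).card ≤ E * (O.card * R.card) + n * w ^ 2 +
      E * ∑ p ∈ O, M * (𝓤.filter fun B => ¬ P B p).card := by
    have e1 : ∑ p ∈ O, (nbr H p.1 p.2).card ≤ O.card * R.card +
        ∑ p ∈ O, (U ∩ nbr H p.1 p.2).card +
        ∑ B ∈ 𝓤, (∑ p ∈ O, (X B ∩ nbr H p.1 p.2).card + ∑ p ∈ O, (Y B ∩ nbr H p.1 p.2).card +
          ∑ p ∈ O, (Z B ∩ nbr H p.1 p.2).card) := by
      refine (sum_le_sum hpt).trans (le_of_eq ?_)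
      rw [sum_add_distrib, sum_add_distrib, sum_const, smul_eq_mul, sum_comm]
      simp only [sum_add_distrib]
    have e2 : E * ∑ B ∈ 𝓤, (∑ p ∈ O, (X B ∩ nbr H p.1 p.2).card +
        ∑ p ∈ O, (Y B ∩ nbr H p.1 p.2).card + ∑ p ∈ O, (Z B ∩ nbr H p.1 p.2).card) ≤
        ∑ B ∈ 𝓤, (3 * M * w ^ 2 + E * ∑ p ∈ O, (if P B p then 0 else M)) := by
      rw [mul_sum]
      refine sum_le_sum fun B h => ?_
      have a1 := hX B h
      have a2 := (h2 B h).le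
      have a3 := (h3 B h).le
      rw [(hB B h).1.2.1] at a2
      rw [(hB B h).1.2.2.1] at a3
      rw [mul_add, mul_add]
      linarith
    have e3 : ∑ B ∈ 𝓤, ∑ p ∈ O, (if P B p then 0 else M) =
        ∑ p ∈ O, M * (𝓤.filter fun B => ¬ P B p).card := by
      rw [sum_comm]
      refine sum_congr rfl fun p _ => ?_
      rw [card_filter, mul_sum]
      refine sum_congr rfl fun B _ => ?_
      by_cases hp : P B p
      · rw [if_pos hp, if_neg (not_not.2 hp), mul_zero]
      · rw [if_neg hp, if_pos hp, mul_one]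
    rw [sum_add_distrib (s := 𝓤) (f := fun _ => 3 * M * w ^ 2), sum_const, ← mul_sum, e3,
      smul_eq_mul] at e2
    have e4 := Nat.mul_le_mul_left E e1
    have e5 := Nat.mul_le_mul_right (w ^ 2) htot
    rw [mul_add, mul_add] at e4
    linarith
  -- label counting
  have hlab : ∀ p ∈ O, (M : ℝ) * (𝓤.filter fun B => ¬ P B p).card ≤
      min (((p.1 : ℕ) + (p.2 : ℕ) : ℝ) / 2) ((n : ℝ) / 2) + γ / 4 * n + 1 / 2 := by
    intro p _
    set 𝓕 := 𝓤.filter fun B => ¬ P B p with h𝓕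
    have hF : ∀ B ∈ 𝓕, B ∈ 𝓤 ∧ ¬ P B p := fun B h => mem_filter.1 h
    have b1 : (M : ℝ) * 𝓕.card ≤ (((p.1 : ℕ) + (p.2 : ℕ) + γ / 2 * n : ℝ) + 1) / 2 := by
      refine label_count hM 𝓕 (hd.subset fun B h => (hF B h).1) (fun B => Y B ∪ Z B) ?_ ?_
        (by positivity) ?_
      · intro B h
        conv_rhs => rw [(hB B (hF B h).1).2]
        rw [union_assoc]
        exact subset_union_right
      · intro B h
        have hb := (hB B (hF B h).1).1
        rw [card_union_of_disjoint (hb.disjoint hH.three hM).2.1, hb.2.1, hb.2.2.1]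
        ring
      · intro B h
        have hb := (hB B (hF B h).1).1
        rw [sum_union (hb.disjoint hH.three hM).2.1]
        exact hP B p (hF B h).2
    have b2 : (3 * (M * 𝓕.card) : ℝ) ≤ n := by
      have : 𝓕.card ≤ 𝓤.card := card_filter_le _ _
      have h6 : 3 * (M * 𝓕.card) ≤ n := by nlinarith [Nat.zero_le (U.card)]
      exact_mod_cast h6
    have b3 : (0 : ℝ) ≤ M * 𝓕.card := by positivity
    have b4 : (0 : ℝ) < γ * n := by linarith
    rw [← sub_le_iff_le_add, ← sub_le_iff_le_add, le_min_iff]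
    constructor <;> linarith
  -- compare
  have hOc : O.card = w * w - w := by rw [hO, hw]; exact offDiag_card _
  have hw2 : w ^ 2 ≤ 2 * O.card := by
    rw [hOc, Nat.mul_sub, sq]
    have : 2 * w ≤ w * w := Nat.mul_le_mul_right _ hW
    omega
  have hOpos : 0 < O.card := by
    have : 0 < w ^ 2 := by positivity
    omega
  have hdeg : ∑ p ∈ O, (min (((p.1 : ℕ) + (p.2 : ℕ) : ℝ) / 2) ((n : ℝ) / 2) + γ * n) ≤
      ((∑ p ∈ O, (nbr H p.1 p.2).card : ℕ) : ℝ) := by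
    push_cast
    exact sum_le_sum fun p hp => hH.deg _ _ (mem_offDiag.1 (hO ▸ hp)).2.2
  have hlabs := sum_le_sum hlab
  rw [sum_add_distrib, sum_const, nsmul_eq_mul] at hdeg
  rw [sum_add_distrib, sum_add_distrib, sum_const, sum_const, nsmul_eq_mul, nsmul_eq_mul] at hlabs
  have hsumR : (E : ℝ) * ((∑ p ∈ O, (nbr H p.1 p.2).card : ℕ) : ℝ) ≤
      E * (O.card * R.card) + n * (w : ℝ) ^ 2 +
      E * ∑ p ∈ O, (M : ℝ) * (𝓤.filter fun B => ¬ P B p).card := by exact_mod_cast hsum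
  have hw2R : (w : ℝ) ^ 2 ≤ 2 * O.card := by exact_mod_cast hw2
  have hOR : (0 : ℝ) < O.card := by exact_mod_cast hOpos
  have hER : (0 : ℝ) < E := by exact_mod_cast hE0
  have hnR : (0 : ℝ) ≤ n := by positivity
  generalize ∑ p ∈ O, min (((p.1 : ℕ) + (p.2 : ℕ) : ℝ) / 2) ((n : ℝ) / 2) = A at *
  generalize ((∑ p ∈ O, (nbr H p.1 p.2).card : ℕ) : ℝ) = S at *
  generalize ∑ p ∈ O, (M : ℝ) * (𝓤.filter fun B => ¬ P B p).card = L at *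
  have k1 : (n : ℝ) * (w : ℝ) ^ 2 ≤ E * (γ / 8 * n * O.card) := by
    have : (n : ℝ) * (w : ℝ) ^ 2 ≤ n * (2 * O.card) := by gcongr
    have h7 : (16 : ℝ) * (n * O.card) ≤ γ * E * (n * O.card) :=
      mul_le_mul_of_nonneg_right hE (by positivity)
    linarith
  have k2 : (E : ℝ) * S ≤ E * (O.card * (γ / 8 * n) + γ / 8 * n * O.card + L) := by
    have : (E : ℝ) * (O.card * R.card) ≤ E * (O.card * (γ / 8 * n)) := by gcongr
    linarith
  have k3 := le_of_mul_le_mul_left k2 hER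
  have k4 : (O.card : ℝ) * 1 < O.card * (γ * n) := mul_lt_mul_of_pos_left hn hOR
  linarith

/-- `𝓤` is a family of disjoint blocks. -/
def BlockFamily {n : ℕ} (H : Finset (Finset (Fin n))) (M : ℕ) (𝓤 : Finset (Finset (Fin n))) :
    Prop :=
  (∀ B ∈ 𝓤, ∃ X Y Z, IsBlock H M X Y Z ∧ B = X ∪ Y ∪ Z) ∧
    (𝓤 : Set (Finset (Fin n))).PairwiseDisjoint id

theorem exists_improvement {γ : ℝ} (hγ0 : 0 < γ) (hγ1 : γ ≤ 1) {m E : ℕ} (hm : 0 < m)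
    (hE : 16 ≤ γ * E) : ∃ N : ℕ, ∀ {n : ℕ} {H : Finset (Finset (Fin n))}, 1 < γ * n →
    PosaCond γ n H → ∀ 𝓤, BlockFamily H (4 * E * m) 𝓤 → ∀ W : Finset (Fin n),
    Disjoint W (𝓤.biUnion id) → N ≤ W.card →
    ((univ \ (W ∪ 𝓤.biUnion id)).card : ℝ) + N ≤ γ / 8 * n →
    ∃ 𝓑 ⊆ 𝓤, ∃ T, Tiled H m T ∧ T ⊆ 𝓑.biUnion id ∪ W ∧ T.card ≤ 6 * (4 * E * m) ∧
      wt (𝓑.biUnion id) + γ / 2 * n * m ≤ wt T := by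
  have hE0 : 0 < E := by
    rcases Nat.eq_zero_or_pos E with rfl | h
    · norm_num at hE
    · exact h
  obtain ⟨N₁, hN₁⟩ := exists_findsBlocks hm hE0
  refine ⟨N₁ + 2 + 4 * m * E, fun {n H} hn hH 𝓤 h𝓤 W hd hW hR => ?_⟩
  obtain ⟨W₀, hW₀, hW₀c⟩ := exists_subset_card_eq (s := W) (n := N₁ + 2) (by omega)
  have hmM : m ≤ 4 * E * m := Nat.le_mul_of_pos_left _ (by omega)
  have hOs : W₀.offDiag ⊆ W₀ ×ˢ W₀ := fun p hp =>
    mem_product.2 ⟨(mem_offDiag.1 hp).1, (mem_offDiag.1 hp).2.1⟩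
  have hγnm : γ / 2 * n * m ≤ n * m := by
    have : (0 : ℝ) ≤ n * m := by positivity
    nlinarith
  have hnm : (0 : ℝ) ≤ n * m := by positivity
  have hUc : 4 * m * E ≤ (W \ W₀).card := by rw [card_sdiff_of_subset hW₀]; omega
  by_cases c1 : (W \ W₀).card * W₀.card ^ 2 ≤
      E * ∑ p ∈ W₀.offDiag, ((W \ W₀) ∩ nbr H p.1 p.2).card
  · obtain ⟨X, hX, W₁, hW₁, W₂, hW₂, hb, -, -⟩ :=
      hN₁ H (W \ W₀) W₀ ∅ _ hOs (by simp) hUc (by omega) c1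
    refine ⟨∅, empty_subset _, X ∪ W₁ ∪ W₂, hb.tiled, ?_, ?_, ?_⟩
    · rw [biUnion_empty, empty_union]
      exact union_subset (union_subset (hX.trans sdiff_subset)
        ((hW₁.trans sdiff_subset).trans hW₀)) ((hW₂.trans sdiff_subset).trans hW₀)
    · rw [hb.card_union hH.three hm]; omega
    · have h1 := le_wt (X ∪ W₁ ∪ W₂)
      rw [hb.card_union hH.three hm] at h1
      have h2 : wt (∅ : Finset (Fin n)) = 0 := sum_empty
      push_cast at h1
      rw [biUnion_empty, h2]
      linarith
  by_contra hcon
  have hdis : ∀ B ∈ 𝓤, Disjoint B W₀ := fun B hB =>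
    (hd.mono hW₀ (subset_biUnion_of_mem id hB)).symm
  have hno : ∀ B ∈ 𝓤, ∀ T, Tiled H m T → T ⊆ B ∪ W₀ → T.card ≤ 6 * (4 * E * m) →
      wt B + γ / 2 * n * m ≤ wt T → False := by
    intro B hB T h1 h2 h3 h4
    refine hcon ⟨{B}, by simpa using hB, T, h1, ?_, h3, by simpa using h4⟩
    rw [singleton_biUnion]
    exact h2.trans (union_subset_union le_rfl hW₀)
  have hdense : ∀ B ∈ 𝓤, ∃ X Y Z : Finset (Fin n), (IsBlock H (4 * E * m) X Y Z ∧ B = X ∪ Y ∪ Z) ∧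
      E * ∑ p ∈ W₀.offDiag, (Y ∩ nbr H p.1 p.2).card < Y.card * W₀.card ^ 2 ∧
      E * ∑ p ∈ W₀.offDiag, (Z ∩ nbr H p.1 p.2).card < Z.card * W₀.card ^ 2 := by
    intro B hB
    have htwo : ∀ X Y Z : Finset (Fin n), IsBlock H (4 * E * m) X Y Z → B = X ∪ Y ∪ Z →
        E * ∑ p ∈ W₀.offDiag, (X ∩ nbr H p.1 p.2).card < X.card * W₀.card ^ 2 ∨
        E * ∑ p ∈ W₀.offDiag, (Y ∩ nbr H p.1 p.2).card < Y.card * W₀.card ^ 2 := by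
      intro X Y Z hb hBe
      by_contra hcc
      rw [not_or, not_lt, not_lt] at hcc
      obtain ⟨T, t1, t2, t3, t4⟩ := improve_two hH.three hm hE0 hN₁ hb (hBe ▸ hdis B hB) hOs
        (by omega) hcc.1 hcc.2
      refine hno B hB T t1 (hBe ▸ t2) t3 ?_
      rw [hBe]
      linarith
    obtain ⟨X, Y, Z, hb, hBe⟩ := h𝓤.1 B hB
    have e1 : B = Y ∪ Z ∪ X := by rw [hBe, union_comm, ← union_assoc, union_comm Z, union_assoc,
      union_comm Z, ← union_assoc, union_comm X, union_assoc, union_comm X, ← union_assoc]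
    have e2 : B = Z ∪ X ∪ Y := by rw [hBe, union_comm, ← union_assoc]
    have k1 := htwo X Y Z hb hBe
    have k2 := htwo Y Z X hb.rot e1
    have k3 := htwo Z X Y hb.rot.rot e2
    by_cases hX : E * ∑ p ∈ W₀.offDiag, (X ∩ nbr H p.1 p.2).card < X.card * W₀.card ^ 2
    · by_cases hY : E * ∑ p ∈ W₀.offDiag, (Y ∩ nbr H p.1 p.2).card < Y.card * W₀.card ^ 2
      · exact ⟨Z, X, Y, ⟨hb.rot.rot, e2⟩, hX, hY⟩
      · exact ⟨Y, Z, X, ⟨hb.rot, e1⟩, k2.resolve_left hY, hX⟩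
    · exact ⟨X, Y, Z, ⟨hb, hBe⟩, k1.resolve_left hX, k3.resolve_right hX⟩
  choose! X Y Z hB hYs hZs using hdense
  refine not_sparse hγ0 (by positivity : 0 < 4 * E * m) hE hn hH 𝓤 h𝓤.2 (W \ W₀) W₀
    (univ \ (W ∪ 𝓤.biUnion id) ∪ W₀) (hd.mono_left sdiff_subset) ?_ ?_ (by omega) X Y Z hB
    (not_le.1 c1) hYs hZs ?_
  · intro v
    simp only [mem_union, mem_sdiff, mem_univ, true_and]
    tauto
  · have h1 := card_union_le (univ \ (W ∪ 𝓤.biUnion id)) W₀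
    have h2 : ((univ \ (W ∪ 𝓤.biUnion id) ∪ W₀).card : ℝ) ≤
        ((univ \ (W ∪ 𝓤.biUnion id)).card : ℝ) + (N₁ + 2 : ℕ) := by
      rw [← hW₀c]; exact_mod_cast h1
    have h3 : ((N₁ + 2 : ℕ) : ℝ) ≤ ((N₁ + 2 + 4 * m * E : ℕ) : ℝ) := by
      exact_mod_cast Nat.le_add_right _ _
    linarith
  · intro B hBU
    by_contra hcc
    rw [not_lt] at hcc
    obtain ⟨hb, hBe⟩ := hB B hBU
    obtain ⟨T, t1, t2, t3, t4⟩ := improve_one (t := γ / 2 * n) hH.three hm hE0 hN₁ hb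
      (hBe ▸ hdis B hBU) ((filter_subset _ _).trans hOs) (by omega)
      (fun p hp => (mem_filter.1 hp).2) hcc
    refine hno B hBU T t1 ?_ t3 ?_
    · exact (congrArg (T ⊆ · ∪ W₀) hBe).mpr t2
    · rw [congrArg wt hBe]
      exact t4

theorem improvement_pass {γ : ℝ} {m E N : ℕ} (hm : 0 < m) {n : ℕ}
    {H : Finset (Finset (Fin n))} (hH : PosaCond γ n H)
    (hI : ∀ 𝓤, BlockFamily H (4 * E * m) 𝓤 → ∀ W : Finset (Fin n),
      Disjoint W (𝓤.biUnion id) → N ≤ W.card →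
      ((univ \ (W ∪ 𝓤.biUnion id)).card : ℝ) + N ≤ γ / 8 * n →
      ∃ 𝓑 ⊆ 𝓤, ∃ T, Tiled H m T ∧ T ⊆ 𝓑.biUnion id ∪ W ∧ T.card ≤ 6 * (4 * E * m) ∧
        wt (𝓑.biUnion id) + γ / 2 * n * m ≤ wt T)
    (hN : N ≤ γ / 32 * n) {Q : Finset (Fin n)} (hQ : Q.card ≤ γ / 16 * n)
    {𝓤 : Finset (Finset (Fin n))} (h𝓤 : BlockFamily H (4 * E * m) 𝓤)
    (hdQ : Disjoint (𝓤.biUnion id) Q) (j : ℕ) (hj : ((6 * (4 * E * m) * j : ℕ) : ℝ) ≤ γ / 32 * n) :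
    ∃ S, Disjoint S Q ∧ Tiled H m S ∧
      ((univ \ (Q ∪ S)).card ≤ N ∨ wt (𝓤.biUnion id) + j * (γ / 2 * n * m) ≤ wt S) := by
  have hsub : ∀ 𝓥 ⊆ 𝓤, BlockFamily H (4 * E * m) 𝓥 := fun 𝓥 h =>
    ⟨fun B hB => h𝓤.1 B (h hB), h𝓤.2.subset (by exact_mod_cast h)⟩
  have htiled : ∀ 𝓥 ⊆ 𝓤, Tiled H m (𝓥.biUnion id) := fun 𝓥 h =>
    Tiled.split hH.three hm ⟨𝓥, (hsub 𝓥 h).1, (hsub 𝓥 h).2, rfl⟩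
  suffices hstate : (∃ S, Disjoint S Q ∧ Tiled H m S ∧ (univ \ (Q ∪ S)).card ≤ N) ∨
      ∃ 𝓥 ⊆ 𝓤, ∃ D, Tiled H m D ∧ Disjoint (𝓥.biUnion id) D ∧ Disjoint D Q ∧
        D.card ≤ 6 * (4 * E * m) * j ∧
        wt (𝓤.biUnion id) + j * (γ / 2 * n * m) ≤ wt (𝓥.biUnion id) + wt D by
    rcases hstate with ⟨S, h1, h2, h3⟩ | ⟨𝓥, h𝓥, D, h1, h2, h3, -, h5⟩
    · exact ⟨S, h1, h2, Or.inl h3⟩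
    · refine ⟨𝓥.biUnion id ∪ D, disjoint_union_left.2
        ⟨hdQ.mono_left (biUnion_subset_biUnion_of_subset_left _ h𝓥), h3⟩,
        (htiled 𝓥 h𝓥).union h1 h2, Or.inr ?_⟩
      rwa [wt_union h2]
  induction j with
  | zero =>
    refine Or.inr ⟨𝓤, le_rfl, ∅, Tiled.empty, disjoint_empty_right _, disjoint_empty_left _,
      by simp, ?_⟩
    have h2 : wt (∅ : Finset (Fin n)) = 0 := sum_empty
    rw [h2]
    simp
  | succ j ih =>
    have hj' : ((6 * (4 * E * m) * j : ℕ) : ℝ) ≤ γ / 32 * n := by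
      refine le_trans ?_ hj
      exact_mod_cast Nat.mul_le_mul_left _ (Nat.le_succ j)
    rcases ih hj' with h | ⟨𝓥, h𝓥, D, hD, hVD, hDQ, hDc, hw⟩
    · exact Or.inl h
    have hVQ : Disjoint (𝓥.biUnion id) Q :=
      hdQ.mono_left (biUnion_subset_biUnion_of_subset_left _ h𝓥)
    set V := 𝓥.biUnion id with hV
    set W := univ \ (Q ∪ (V ∪ D)) with hW
    by_cases hWN : W.card ≤ N
    · exact Or.inl ⟨V ∪ D, disjoint_union_left.2 ⟨hVQ, hDQ⟩, (htiled 𝓥 h𝓥).union hD hVD, hWN⟩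
    have hrest : univ \ (W ∪ V) ⊆ Q ∪ D := by
      intro a
      simp only [hW, mem_sdiff, mem_union, mem_univ, true_and]
      tauto
    have hrc : ((univ \ (W ∪ V)).card : ℝ) ≤ Q.card + D.card := by
      exact_mod_cast (card_le_card hrest).trans (card_union_le _ _)
    have hDc' : (D.card : ℝ) ≤ γ / 32 * n := le_trans (by exact_mod_cast hDc) hj'
    obtain ⟨𝓑, h𝓑, T, hT, hTs, hTc, hTw⟩ := hI 𝓥 (hsub 𝓥 h𝓥) W
      (by
        rw [disjoint_left]; intro a ha
        simp only [hW, mem_sdiff, mem_union, mem_univ, true_and] at ha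
        tauto) (by omega) (by linarith)
    have hsd : Disjoint ((𝓥 \ 𝓑).biUnion id) (𝓑.biUnion id) := by
      rw [disjoint_biUnion_left]
      intro A hA
      rw [disjoint_biUnion_right]
      intro B hB
      refine (hsub 𝓥 h𝓥).2 (mem_coe.2 (mem_sdiff.1 hA).1) (mem_coe.2 (h𝓑 hB)) ?_
      rintro rfl
      exact (mem_sdiff.1 hA).2 hB
    have hun : (𝓥 \ 𝓑).biUnion id ∪ 𝓑.biUnion id = V := by
      rw [← union_biUnion, sdiff_union_of_subset h𝓑]
    have hBV : 𝓑.biUnion id ⊆ V := hun ▸ subset_union_right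
    have hRV : (𝓥 \ 𝓑).biUnion id ⊆ V := hun ▸ subset_union_left
    have hTa : ∀ a ∈ T, (a ∈ 𝓑.biUnion id) ∨ a ∈ W := fun a ha => mem_union.1 (hTs ha)
    have hWa : ∀ a ∈ W, a ∉ Q ∧ a ∉ V ∧ a ∉ D := by
      intro a ha
      simp only [hW, mem_sdiff, mem_union, mem_univ, true_and] at ha
      tauto
    have hDT : Disjoint D T := by
      rw [disjoint_right]
      intro a ha
      rcases hTa a ha with h | h
      · exact disjoint_left.1 hVD (hBV h)
      · exact (hWa a h).2.2
    refine Or.inr ⟨𝓥 \ 𝓑, sdiff_subset.trans h𝓥, D ∪ T, hD.union hT hDT, ?_, ?_, ?_, ?_⟩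
    · refine disjoint_union_right.2 ⟨hVD.mono_left hRV, ?_⟩
      rw [disjoint_right]
      intro a ha
      rcases hTa a ha with h | h
      · exact disjoint_right.1 hsd h
      · exact fun h' => (hWa a h).2.1 (hRV h')
    · refine disjoint_union_left.2 ⟨hDQ, ?_⟩
      rw [disjoint_left]
      intro a ha
      rcases hTa a ha with h | h
      · exact disjoint_left.1 hVQ (hBV h)
      · exact (hWa a h).1
    · refine (card_union_le _ _).trans ?_
      rw [mul_add, mul_one]
      exact Nat.add_le_add hDc hTc
    · rw [wt_union hDT]
      have h1 : wt V = wt ((𝓥 \ 𝓑).biUnion id) + wt (𝓑.biUnion id) := by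
        rw [← hun, wt_union hsd]
      push_cast
      linarith

theorem exists_tiling_or_heavy {γ : ℝ} (hγ0 : 0 < γ) (hγ1 : γ ≤ 1) {E : ℕ}
    (hE : 16 ≤ γ * E) (p : ℕ) : ∀ m : ℕ, 0 < m → ∃ N : ℕ, ∀ {n : ℕ}
    {H : Finset (Finset (Fin n))}, N ≤ n → PosaCond γ n H → ∀ Q : Finset (Fin n),
    Q.card ≤ γ / 16 * n → ∃ S, Disjoint S Q ∧ Tiled H m S ∧
      ((univ \ (Q ∪ S)).card ≤ N ∨ p * (γ ^ 2 / (3072 * E) * n ^ 2) ≤ wt S) := by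
  have hE0 : 0 < E := by
    rcases Nat.eq_zero_or_pos E with rfl | h
    · norm_num at hE
    · exact h
  have hER : (0 : ℝ) < E := by exact_mod_cast hE0
  induction p with
  | zero =>
    intro m hm
    refine ⟨0, fun {n H} _ _ Q _ => ⟨∅, disjoint_empty_left _, Tiled.empty, Or.inr ?_⟩⟩
    have h2 : wt (∅ : Finset (Fin n)) = 0 := sum_empty
    rw [h2]
    simp
  | succ p ih =>
    intro m hm
    have hM : 0 < 4 * E * m := by positivity
    obtain ⟨N₁, hN₁⟩ := ih (4 * E * m) hM
    obtain ⟨N₂, hN₂⟩ := exists_improvement hγ0 hγ1 hm hE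
    obtain ⟨N₃, hN₃⟩ := exists_nat_gt ((2 + 32 * N₂ + 384 * (4 * E * m : ℕ)) / γ)
    refine ⟨N₁ + N₂ + N₃, fun {n H} hn hH Q hQ => ?_⟩
    have hnR : 2 + 32 * N₂ + 384 * ((4 * E * m : ℕ) : ℝ) ≤ γ * n := by
      rw [div_lt_iff₀ hγ0] at hN₃
      have : (N₃ : ℝ) ≤ n := by exact_mod_cast (by omega : N₃ ≤ n)
      nlinarith
    have hN₂0 : (0 : ℝ) ≤ N₂ := by positivity
    have hM0 : (0 : ℝ) < ((4 * E * m : ℕ) : ℝ) := by exact_mod_cast hM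
    have hmR : (0 : ℝ) < m := by exact_mod_cast hm
    obtain ⟨S, hSQ, hS, hS'⟩ := hN₁ (by omega : N₁ ≤ n) hH Q hQ
    rcases hS' with hS' | hS'
    · exact ⟨S, hSQ, hS.split hH.three hm, Or.inl (by omega)⟩
    obtain ⟨𝓤, h1, h2, rfl⟩ := hS
    set M := 4 * E * m with hMdef
    have hx0 : 0 ≤ γ * n / (192 * (M : ℝ)) := div_nonneg (by linarith) (by linarith)
    have hJ1 := Nat.floor_le hx0
    have hJ2 := Nat.lt_floor_add_one (γ * n / (192 * (M : ℝ)))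
    set J := ⌊γ * n / (192 * (M : ℝ))⌋₊ with hJ
    rw [le_div_iff₀ (by linarith)] at hJ1
    rw [div_lt_iff₀ (by linarith)] at hJ2
    obtain ⟨S, s1, s2, s3⟩ := improvement_pass hm hH
      (fun 𝓤 h W => hN₂ (by linarith) hH 𝓤 h W) (by linarith) hQ ⟨h1, h2⟩ hSQ J
      (by push_cast [← hMdef]; linarith)
    refine ⟨S, s1, s2, s3.imp (fun h => by omega) fun h => le_trans ?_ h⟩
    have h5 : γ ^ 2 / (3072 * E) * n ^ 2 ≤ J * (γ / 2 * n * m) := by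
      rw [div_mul_eq_mul_div, div_le_iff₀ (by linarith)]
      have h6 : γ * n ≤ 384 * M * J := by linarith
      have h7 : (M : ℝ) = 4 * E * m := by rw [hMdef]; push_cast; ring
      rw [h7] at h6
      have h8 : (0 : ℝ) ≤ γ * n := by linarith
      nlinarith [mul_le_mul_of_nonneg_left h6 h8]
    push_cast
    linarith

theorem exists_tiling {γ : ℝ} (hγ0 : 0 < γ) (hγ1 : γ ≤ 1) {m : ℕ} (hm : 0 < m) :
    ∃ N : ℕ, ∀ {n : ℕ} {H : Finset (Finset (Fin n))}, N ≤ n → PosaCond γ n H →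
    ∀ Q : Finset (Fin n), Q.card ≤ γ / 16 * n → ∃ S, Disjoint S Q ∧ Tiled H m S ∧
      (univ \ (Q ∪ S)).card ≤ N := by
  obtain ⟨E, hE⟩ := exists_nat_gt (16 / γ)
  have hE' : 16 ≤ γ * E := by
    rw [div_lt_iff₀ hγ0] at hE
    linarith
  have hER : (0 : ℝ) < E := lt_trans (by positivity) hE
  have hξ : 0 < γ ^ 2 / (3072 * E) := by positivity
  obtain ⟨p, hp⟩ := exists_nat_gt (2 / (γ ^ 2 / (3072 * E)))
  rw [div_lt_iff₀ hξ] at hp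
  obtain ⟨N, hN⟩ := exists_tiling_or_heavy hγ0 hγ1 hE' p m hm
  refine ⟨N + 1, fun {n H} hn hH Q hQ => ?_⟩
  obtain ⟨S, h1, h2, h3 | h3⟩ := hN (by omega : N ≤ n) hH Q hQ
  · exact ⟨S, h1, h2, by omega⟩
  · exfalso
    have h4 := wt_le S
    have h5 : (S.card : ℝ) ≤ n := by
      have := card_le_univ S
      rw [Fintype.card_fin] at this
      exact_mod_cast this
    have hn0 : (0 : ℝ) < n := by
      have : 0 < n := by omega
      exact_mod_cast this
    have h6 : 2 * (n : ℝ) * S.card ≤ 2 * n * n := by gcongr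
    have h7 : (2 : ℝ) * n ^ 2 < p * (γ ^ 2 / (3072 * E)) * n ^ 2 :=
      mul_lt_mul_of_pos_right hp (by positivity)
    nlinarith

/-- Interleaving of three lists. -/
def weave {α : Type*} : List α → List α → List α → List α
  | x :: X, y :: Y, z :: Z => x :: y :: z :: weave X Y Z
  | _, _, _ => []

theorem tight_weave {n : ℕ} {H : Finset (Finset (Fin n))} : ∀ {X Y Z : List (Fin n)},
    (∀ x ∈ X, ∀ y ∈ Y, ∀ z ∈ Z, Edge H x y z) → Tight H (weave X Y Z)
  | [], _, _, _ => by simp [weave, Tight]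
  | _ :: _, [], _, _ => by simp [weave, Tight]
  | _ :: _, _ :: _, [], _ => by simp [weave, Tight]
  | [x], y :: Y, z :: Z, h => by
      simp only [weave, Tight, and_true]
      exact h _ (by simp) _ (by simp) _ (by simp)
  | x :: _ :: _, [y], z :: Z, h => by
      simp only [weave, Tight, and_true]
      exact h _ (by simp) _ (by simp) _ (by simp)
  | x :: _ :: _, y :: _ :: _, [z], h => by
      simp only [weave, Tight, and_true]
      exact h _ (by simp) _ (by simp) _ (by simp)
  | x :: x' :: X, y :: y' :: Y, z :: z' :: Z, h => by
      have ih := tight_weave (X := x' :: X) (Y := y' :: Y) (Z := z' :: Z)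
        fun a ha b hb c hc => h a (List.mem_cons_of_mem _ ha) b (List.mem_cons_of_mem _ hb) c
          (List.mem_cons_of_mem _ hc)
      simp only [weave] at ih ⊢
      refine ⟨h _ (by simp) _ (by simp) _ (by simp), ?_, ?_, ih⟩
      · exact (h x' (by simp) y (by simp) z (by simp)).rot
      · exact (h x' (by simp) y' (by simp) z (by simp)).rot.rot

theorem weave_perm {α : Type*} : ∀ {X Y Z : List α}, X.length = Y.length → Y.length = Z.length →
    (weave X Y Z).Perm (X ++ Y ++ Z)
  | [], [], [], _, _ => by simp [weave]
  | x :: X, y :: Y, z :: Z, h1, h2 => by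
      have ih := weave_perm (X := X) (Y := Y) (Z := Z) (by simpa using h1) (by simpa using h2)
      simp only [weave]
      rw [← Multiset.coe_eq_coe] at ih ⊢
      simp only [← Multiset.cons_coe, ← Multiset.coe_add, ih]
      simp only [Multiset.cons_add, Multiset.add_cons]
      rw [Multiset.cons_swap x y, Multiset.cons_swap x z, Multiset.cons_swap y z]

theorem IsBlock.exists_piece {n m : ℕ} {H : Finset (Finset (Fin n))} {X Y Z : Finset (Fin n)}
    (h3 : Is3Graph n H) (hm : 2 ≤ m) (h : IsBlock H m X Y Z) :
    ∃ e P, PieceOf H e P ∧ P.Nodup ∧ (∀ x, x ∈ P ↔ x ∈ X ∪ Y ∪ Z) ∧ P.length = 3 * m := by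
  obtain ⟨dXY, dYZ, dXZ⟩ := h.disjoint h3 (by omega)
  have hp : (weave X.toList Y.toList Z.toList).Perm (X.toList ++ Y.toList ++ Z.toList) :=
    weave_perm (by simp [h.1, h.2.1]) (by simp [h.2.2.1, h.2.1])
  have hl : (weave X.toList Y.toList Z.toList).length = 3 * m := by
    rw [hp.length_eq]; simp [h.1, h.2.1, h.2.2.1]; ring
  obtain ⟨e, he⟩ := exists_pieceOf (H := H) (P := weave X.toList Y.toList Z.toList)
    (tight_weave fun x hx y hy z hz => h.2.2.2 x (mem_toList.1 hx) y (mem_toList.1 hy) z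
      (mem_toList.1 hz)) (by omega)
  refine ⟨e, _, he, ?_, fun x => ?_, hl⟩
  · rw [hp.nodup_iff, List.nodup_append, List.nodup_append]
    refine ⟨⟨nodup_toList _, nodup_toList _, ?_⟩, nodup_toList _, ?_⟩
    · rintro a ha _ hb rfl
      exact disjoint_left.1 dXY (mem_toList.1 ha) (mem_toList.1 hb)
    · rintro a ha _ hb rfl
      rw [List.mem_append, mem_toList, mem_toList] at ha
      rw [mem_toList] at hb
      rcases ha with ha | ha
      · exact disjoint_left.1 dXZ ha hb
      · exact disjoint_left.1 dYZ ha hb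
  · rw [hp.mem_iff]
    simp

theorem Tiled.exists_pieces {n m : ℕ} {H : Finset (Finset (Fin n))} {S : Finset (Fin n)}
    (h3 : Is3Graph n H) (hm : 2 ≤ m) (h : Tiled H m S) :
    ∃ es Ps, List.Forall₂ (PieceOf H) es Ps ∧ Ps.flatten.Nodup ∧ (∀ x, x ∈ Ps.flatten ↔ x ∈ S) ∧
      Ps.length * (3 * m) = S.card := by
  obtain ⟨𝓤, h1, h2, rfl⟩ := h
  induction 𝓤 using Finset.induction_on with
  | empty => exact ⟨[], [], List.Forall₂.nil, by simp, by simp, by simp⟩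
  | insert B 𝓤 hB ih =>
    obtain ⟨es, Ps, i1, i2, i3, i4⟩ :=
      ih (fun B' hB' => h1 B' (mem_insert_of_mem hB')) (h2.subset (by simp))
    obtain ⟨X, Y, Z, hb, hBe⟩ := h1 B (mem_insert_self _ _)
    obtain ⟨e, P, p1, p2, p3, p4⟩ := hb.exists_piece h3 hm
    have hd : Disjoint B (𝓤.biUnion id) := by
      rw [disjoint_biUnion_right]
      intro B' hB'
      exact h2 (by simp) (by simp [hB']) (by rintro rfl; exact hB hB')
    refine ⟨e :: es, P :: Ps, List.Forall₂.cons p1 i1, ?_, ?_, ?_⟩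
    · rw [List.flatten_cons, List.nodup_append]
      refine ⟨p2, i2, ?_⟩
      rintro a ha _ hb' rfl
      rw [p3, ← hBe] at ha
      rw [i3] at hb'
      exact disjoint_left.1 hd ha hb'
    · intro x
      rw [List.flatten_cons, List.mem_append, i3, p3, ← hBe, biUnion_insert, mem_union, id]
    · rw [biUnion_insert, id, card_union_of_disjoint hd, ← i4, List.length_cons]
      have : B.card = 3 * m := by rw [hBe]; exact hb.card_union h3 (by omega)
      rw [this]; ring

theorem forall₂_append_split {α β : Type*} {R : α → β → Prop} : ∀ {A B : List β} {u : List α},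
    List.Forall₂ R u (A ++ B) → ∃ u₁ u₂, u = u₁ ++ u₂ ∧ List.Forall₂ R u₁ A ∧ List.Forall₂ R u₂ B
  | [], B, u, h => ⟨[], u, rfl, List.Forall₂.nil, h⟩
  | a :: A, B, _ :: u, List.Forall₂.cons h1 h2 => by
      obtain ⟨u₁, u₂, rfl, h3, h4⟩ := forall₂_append_split h2
      exact ⟨_ :: u₁, u₂, rfl, List.Forall₂.cons h1 h3, h4⟩

theorem forall₂_append {α β : Type*} {R : α → β → Prop} : ∀ {A B : List β} {u v : List α},
    List.Forall₂ R u A → List.Forall₂ R v B → List.Forall₂ R (u ++ v) (A ++ B)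
  | [], _, _, _, List.Forall₂.nil, h => h
  | _ :: _, _, _ :: _, _, List.Forall₂.cons h1 h2, h => List.Forall₂.cons h1 (forall₂_append h2 h)

/-- Both end pairs consist of distinct vertices. -/
def Proper {n : ℕ} (e : (Fin n × Fin n) × (Fin n × Fin n)) : Prop :=
  e.1.1 ≠ e.1.2 ∧ e.2.1 ≠ e.2.2

/-- At least `t` members of `F` join any two given pairs. -/
def Connects {n : ℕ} (H : Finset (Finset (Fin n))) (F : List (List (Fin n))) (t : ℕ) : Prop :=
  ∀ e f : Fin n × Fin n, e.1 ≠ e.2 → f.1 ≠ f.2 → t ≤ F.countP fun l => decide (Joins H e f l)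

theorem Connects.exists_mem {n : ℕ} {H : Finset (Finset (Fin n))} {F : List (List (Fin n))} {t : ℕ}
    (hF : Connects H F (t + 1)) {e f : Fin n × Fin n} (he : e.1 ≠ e.2) (hf : f.1 ≠ f.2) :
    ∃ C ∈ F, Joins H e f C ∧ Connects H (F.erase C) t := by
  obtain ⟨C, hC, hCJ⟩ := List.countP_pos_iff.1 (lt_of_lt_of_le (Nat.succ_pos t) (hF e f he hf))
  refine ⟨C, hC, of_decide_eq_true hCJ, fun a b ha hb => ?_⟩
  have h1 := hF a b ha hb
  rw [(List.perm_cons_erase hC).countP_eq, List.countP_cons] at h1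
  split_ifs at h1 <;> omega

theorem exists_chain {n : ℕ} {H : Finset (Finset (Fin n))} :
    ∀ (es : List ((Fin n × Fin n) × (Fin n × Fin n))) (e : (Fin n × Fin n) × (Fin n × Fin n))
      (F : List (List (Fin n))) (t : ℕ), Connects H F (es.length + t) → Proper e →
      (∀ f ∈ es, Proper f) →
      ∃ Cs F' d, F.Perm (Cs ++ F') ∧ d.1 ≠ d.2 ∧ Connects H F' t ∧
        ∀ P Ps, PieceOf H e P → List.Forall₂ (PieceOf H) es Ps →
          ∃ R, PieceOf H (e.1, d) R ∧ R.Perm (P ++ Ps.flatten ++ Cs.flatten)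
  | [], e, F, t, hF, he, _ => by
      refine ⟨[], F, e.2, by simp, he.2, by simpa using hF, fun P Ps hP hPs => ⟨P, hP, ?_⟩⟩
      cases hPs
      simp
  | f :: es, e, F, t, hF, he, hes => by
      rw [List.length_cons, add_right_comm] at hF
      have hf := hes f (by simp)
      obtain ⟨C, hC, hJ, hF'⟩ := hF.exists_mem he.2 hf.1
      obtain ⟨Cs, F', d, h1, h2, h3, h4⟩ := exists_chain es (e.1, f.2) (F.erase C) t hF'
        ⟨he.1, hf.2⟩ fun g hg => hes g (List.mem_cons_of_mem _ hg)
      refine ⟨C :: Cs, F', d, (List.perm_cons_erase hC).trans (h1.cons C), h2, h3, ?_⟩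
      intro P Ps hP hPs
      cases hPs with
      | cons hQ hPs =>
        obtain ⟨R, r1, r2⟩ := h4 _ _ (hP.join hJ hQ) hPs
        refine ⟨R, r1, r2.trans ?_⟩
        rw [← Multiset.coe_eq_coe]
        simp only [List.flatten_cons, ← Multiset.coe_add]
        ac_rfl

theorem PieceOf.unique {n : ℕ} {H : Finset (Finset (Fin n))}
    {e f : (Fin n × Fin n) × (Fin n × Fin n)} {l : List (Fin n)} (he : PieceOf H e l)
    (hf : PieceOf H f l) : e = f := by
  obtain ⟨⟨a, b⟩, c, d⟩ := e
  obtain ⟨⟨a', b'⟩, c', d'⟩ := f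
  obtain ⟨-, m, rfl⟩ := he
  obtain ⟨-, m', h⟩ := hf
  simp only [List.cons.injEq] at h
  obtain ⟨h1, h2, h3⟩ := h
  have := (List.append_inj' h3 rfl).2
  simp_all

theorem exists_absorb {n : ℕ} {H : Finset (Finset (Fin n))} :
    ∀ (S : List (Fin n)) (es : List ((Fin n × Fin n) × (Fin n × Fin n))) (F : List (List (Fin n))),
      List.Forall₂ (PieceOf H) es F →
      (∀ v ∈ S, S.length ≤ F.countP fun l => decide (Absorber H v l)) →
      ∃ Ps, List.Forall₂ (PieceOf H) es Ps ∧ Ps.flatten.Perm (F.flatten ++ S)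
  | [], es, F, h, _ => ⟨F, h, by simp⟩
  | v :: S, es, F, h, hS => by
      obtain ⟨l, hl, hvl⟩ := List.countP_pos_iff.1
        (lt_of_lt_of_le (by simp) (hS v (by simp)))
      obtain ⟨A, B, rfl⟩ := List.append_of_mem hl
      obtain ⟨eA, eB', rfl, hA, hB'⟩ := forall₂_append_split h
      obtain ⟨g, g1, l', g2, g3⟩ := of_decide_eq_true hvl
      cases hB' with
      | @cons e _ eB _ hel hB =>
        obtain rfl := g1.unique hel
        obtain ⟨Ps, p1, p2⟩ := exists_absorb S (eA ++ eB) (A ++ B) (forall₂_append hA hB) (by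
          intro w hw
          have h1 := hS w (List.mem_cons_of_mem _ hw)
          rw [List.countP_append, List.countP_cons, List.length_cons] at h1
          rw [List.countP_append]
          split_ifs at h1 <;> omega)
        obtain ⟨PA, PB, rfl, q1, q2⟩ := forall₂_append_split p1.flip
        refine ⟨PA ++ l' :: PB, forall₂_append q1.flip (List.Forall₂.cons g2 q2.flip), ?_⟩
        rw [← Multiset.coe_eq_coe] at p2 g3 ⊢
        simp only [List.flatten_append, List.flatten_cons, ← Multiset.coe_add,
          ← Multiset.cons_coe] at p2 g3 ⊢
        rw [g3]
        calc _ = v ::ₘ ((l : Multiset (Fin n)) + ((PA.flatten : Multiset (Fin n)) + PB.flatten)) := by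
              simp only [Multiset.cons_add, Multiset.add_cons]
              congr 1
              ac_rfl
          _ = _ := by
              rw [p2]
              simp only [Multiset.add_cons]
              congr 1
              ac_rfl

theorem exists_connectors {γ : ℝ} (hγ0 : 0 < γ) (hγ1 : γ ≤ 1) :
    ∃ L : ℕ, ∃ β : ℝ, 0 < β ∧ ∀ ρ : ℝ, 0 < ρ → ρ ≤ β → ∃ κ : ℝ, 0 < κ ∧ ∃ n₀ : ℕ,
      ∀ {n : ℕ} {H : Finset (Finset (Fin n))}, n₀ ≤ n → PosaCond γ n H →
      ∀ Q : Finset (Fin n), (Q.card : ℝ) ≤ β * n → ∃ F : List (List (Fin n)),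
        (F.flatten.length : ℝ) ≤ L * (ρ * n) ∧ F.flatten.Nodup ∧ (∀ x ∈ F.flatten, x ∉ Q) ∧
        ∀ t : ℕ, (t : ℝ) ≤ κ * n → Connects H F t := by
  obtain ⟨L, c, hL0, hc, hL⟩ := exists_manyJoins hγ0 hγ1
  obtain ⟨β, hβ, hsel⟩ := exists_selection hL0 (lt_min hc one_pos) (min_le_right c 1)
  obtain ⟨N, hN⟩ := exists_nat_ge (6 / γ)
  rw [div_le_iff₀ hγ0] at hN
  refine ⟨L, β, hβ, fun ρ hρ0 hρ => ?_⟩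
  obtain ⟨κ, hκ, n₀, hn₀⟩ := hsel ρ hρ0 hρ
  refine ⟨κ, hκ, n₀ + N, fun {n H} hn hH Q hQ => ?_⟩
  have hn6 : 6 ≤ γ * n := by
    have : (N : ℝ) ≤ n := by exact_mod_cast (by omega : N ≤ n)
    nlinarith
  have hJ := fun (i : (Fin n × Fin n) × (Fin n × Fin n)) (hi : Proper i) =>
    hL n hn6 H hH i.1 i.2 hi.1 hi.2
  choose! S hS hSc using hJ
  obtain ⟨F, f1, f2, f3, f4, f5⟩ := hn₀ n (by omega)
    (univ.filter fun i : (Fin n × Fin n) × (Fin n × Fin n) => Proper i) (by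
      refine (card_le_univ _).trans (le_of_eq ?_)
      simp only [Fintype.card_prod, Fintype.card_fin]; ring) S (fun i hi => by
      have hi' := (mem_filter.1 hi).2
      refine ⟨fun l hl => (hS i hi' l hl).1, le_trans ?_ (hSc i hi')⟩
      gcongr
      exact min_le_left _ _) Q hQ
  refine ⟨F, ?_, f3, f4, ?_⟩
  · have h1 : F.flatten.length = F.length * L := by
      rw [List.length_flatten, List.sum_eq_card_nsmul _ L, List.length_map, smul_eq_mul]
      intro x hx
      obtain ⟨l, hl, rfl⟩ := List.mem_map.1 hx
      obtain ⟨i, hi, hli⟩ := f2 l hl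
      exact (hS i (mem_filter.1 hi).2 l hli).1
    rw [h1]
    push_cast
    rw [mul_comm]
    gcongr
  · intro t ht e f he hf
    have h1 := f5 (e, f) (mem_filter.2 ⟨mem_univ _, he, hf⟩)
    have h2 : t ≤ F.countP fun l => decide (l ∈ S (e, f)) := by exact_mod_cast ht.trans h1
    refine h2.trans (List.countP_mono_left fun l _ hl => ?_)
    exact decide_eq_true (hS (e, f) ⟨he, hf⟩ l (of_decide_eq_true hl)).2

theorem exists_absorber_family {γ : ℝ} (hγ0 : 0 < γ) (hγ1 : γ ≤ 1) :
    ∃ K : ℕ, ∃ β : ℝ, 0 < β ∧ ∀ ρ : ℝ, 0 < ρ → ρ ≤ β → ∃ κ : ℝ, 0 < κ ∧ ∃ n₀ : ℕ,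
      ∀ {n : ℕ} {H : Finset (Finset (Fin n))}, n₀ ≤ n → PosaCond γ n H →
      ∀ Q : Finset (Fin n), (Q.card : ℝ) ≤ β * n → ∃ F : List (List (Fin n)),
        (F.length : ℝ) ≤ ρ * n ∧ (F.flatten.length : ℝ) ≤ K * (ρ * n) ∧ F.flatten.Nodup ∧
        (∀ x ∈ F.flatten, x ∉ Q) ∧ (∀ l ∈ F, ∃ e, PieceOf H e l) ∧
        ∀ v, ∀ t : ℕ, (t : ℝ) ≤ κ * n → t ≤ F.countP fun l => decide (Absorber H v l) := by
  obtain ⟨K, c, hK0, hc, hK⟩ := exists_absorbers hγ0 hγ1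
  obtain ⟨β, hβ, hsel⟩ := exists_selection hK0 (lt_min hc one_pos) (min_le_right c 1)
  obtain ⟨N, hN⟩ := exists_nat_ge (6 / γ)
  rw [div_le_iff₀ hγ0] at hN
  refine ⟨K, β, hβ, fun ρ hρ0 hρ => ?_⟩
  obtain ⟨κ, hκ, n₀, hn₀⟩ := hsel ρ hρ0 hρ
  refine ⟨κ, hκ, n₀ + N, fun {n H} hn hH Q hQ => ?_⟩
  have hn6 : 6 ≤ γ * n := by
    have : (N : ℝ) ≤ n := by exact_mod_cast (by omega : N ≤ n)
    nlinarith
  choose S hS hSc using hK n hn6 H hH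
  obtain ⟨F, f1, f2, f3, f4, f5⟩ := hn₀ n (by omega) (univ : Finset (Fin n))
    (by simpa using Nat.le_self_pow (by norm_num) n) S (fun i _ => by
      refine ⟨fun l hl => (hS i l hl).1, le_trans ?_ (hSc i)⟩
      gcongr
      exact min_le_left _ _) Q hQ
  refine ⟨F, f1, ?_, f3, f4, ?_, ?_⟩
  · have h1 : F.flatten.length = F.length * K := by
      rw [List.length_flatten, List.sum_eq_card_nsmul _ K, List.length_map, smul_eq_mul]
      intro x hx
      obtain ⟨l, hl, rfl⟩ := List.mem_map.1 hx
      obtain ⟨i, hi, hli⟩ := f2 l hl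
      exact (hS i l hli).1
    rw [h1]
    push_cast
    rw [mul_comm]
    gcongr
  · intro l hl
    obtain ⟨i, -, hli⟩ := f2 l hl
    obtain ⟨e, he, -⟩ := (hS i l hli).2
    exact ⟨e, he⟩
  · intro v t ht
    have h1 := f5 v (mem_univ _)
    have h2 : t ≤ F.countP fun l => decide (l ∈ S v) := by exact_mod_cast ht.trans h1
    refine h2.trans (List.countP_mono_left fun l _ hl => ?_)
    exact decide_eq_true (hS v l (of_decide_eq_true hl)).2

theorem hasTightHamiltonCycle_of_list {n : ℕ} {H : Finset (Finset (Fin n))} {a b : Fin n}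
    {l : List (Fin n)} (ht : Tight H (a :: b :: l ++ [a, b])) (hd : (a :: b :: l).Nodup)
    (hs : ∀ x, x ∈ a :: b :: l) : HasTightHamiltonCycle H := by
  have hlen : (a :: b :: l).length = n := by
    have h1 : (a :: b :: l).toFinset = univ := by ext x; simpa using hs x
    have h2 := List.toFinset_card_of_nodup hd
    rw [h1, card_univ, Fintype.card_fin] at h2
    exact h2.symm
  have hn : 2 ≤ n := by rw [← hlen]; simp
  have : NeZero n := ⟨by omega⟩
  have hlt : ∀ i : ZMod n, i.val < (a :: b :: l).length := fun i => by
    rw [hlen]; exact ZMod.val_lt i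
  have hinj : Function.Injective fun i : ZMod n => (a :: b :: l)[i.val]'(hlt i) := by
    intro i j hij
    exact ZMod.val_injective n ((List.Nodup.getElem_inj_iff hd).1 hij)
  have hbij : Function.Bijective fun i : ZMod n => (a :: b :: l)[i.val]'(hlt i) := by
    rw [Fintype.bijective_iff_injective_and_card]
    exact ⟨hinj, by simp [ZMod.card]⟩
  refine ⟨Equiv.ofBijective _ hbij, fun i => ?_⟩
  have hi : i.val < n := ZMod.val_lt i
  have hext : ∀ k (hk : k < (a :: b :: l ++ [a, b]).length) (h' : k % n < (a :: b :: l).length),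
      (a :: b :: l ++ [a, b])[k] = (a :: b :: l)[k % n] := by
    intro k hk h'
    rw [List.length_append, hlen] at hk
    rw [hlen] at h'
    rcases lt_or_ge k n with h | h
    · rw [List.getElem_append_left (by omega)]
      simp only [Nat.mod_eq_of_lt h]
    · rw [List.getElem_append_right (by omega)]
      have h2 : k % n = k - n := by
        rw [Nat.mod_eq_sub_mod h, Nat.mod_eq_of_lt]
        simp at hk
        omega
      simp only [h2, hlen]
      have h3 : k - n < 2 := by simp at hk; omega
      obtain h4 | h4 : k - n = 0 ∨ k - n = 1 := by omega
      all_goals simp only [h4]; rfl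
  have he := ht.edge i.val (by rw [List.length_append, hlen]; simp; omega)
  have hv1 : (i + 1).val = (i.val + 1) % n := by
    rw [ZMod.val_add, ZMod.val_one_eq_one_mod, Nat.add_mod_mod]
  have hv2 : (i + 2).val = (i.val + 2) % n := by
    rw [ZMod.val_add, ZMod.val_two_eq_two_mod, Nat.add_mod_mod]
  have hm : ∀ k, k % n < (a :: b :: l).length := fun k => by
    rw [hlen]; exact Nat.mod_lt _ (by omega)
  rw [hext _ _ (hm _), hext _ _ (hm _), hext _ _ (hm _)] at he
  simp only [Equiv.ofBijective_apply, hv1, hv2]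
  simpa only [Edge, Nat.mod_eq_of_lt hi] using he

theorem PieceOf.hasTightHamiltonCycle {n : ℕ} {H : Finset (Finset (Fin n))}
    {e : (Fin n × Fin n) × (Fin n × Fin n)} {R C : List (Fin n)} (hR : PieceOf H e R)
    (hC : Joins H e.2 e.1 C) (hd : (R ++ C).Nodup) (hs : ∀ x, x ∈ R ++ C) :
    HasTightHamiltonCycle H := by
  obtain ⟨tR, m, rfl⟩ := hR
  have h1 := tight_glue (A := e.1.1 :: e.1.2 :: m) (B := C ++ [e.1.1, e.1.2])
    (by simpa using tR) hC
  exact hasTightHamiltonCycle_of_list (a := e.1.1) (b := e.1.2) (l := m ++ [e.2.1, e.2.2] ++ C)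
    (by simpa using h1) (by simpa using hd) (by simpa using hs)

theorem exists_proper_ends {n : ℕ} {H : Finset (Finset (Fin n))} : ∀ {F : List (List (Fin n))},
    F.flatten.Nodup → (∀ l ∈ F, ∃ e, PieceOf H e l) →
    ∃ es, List.Forall₂ (PieceOf H) es F ∧ ∀ e ∈ es, Proper e
  | [], _, _ => ⟨[], List.Forall₂.nil, by simp⟩
  | l :: F, hd, hF => by
      rw [List.flatten_cons, List.nodup_append] at hd
      obtain ⟨es, h1, h2⟩ := exists_proper_ends hd.2.1 fun l hl => hF l (List.mem_cons_of_mem _ hl)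
      obtain ⟨e, he⟩ := hF l (by simp)
      refine ⟨e :: es, List.Forall₂.cons he h1, fun f hf => ?_⟩
      rcases List.mem_cons.1 hf with rfl | hf
      · exact he.ne hd.1
      · exact h2 f hf

theorem Proper.of_forall₂ {n : ℕ} {H : Finset (Finset (Fin n))} :
    ∀ {es : List ((Fin n × Fin n) × (Fin n × Fin n))} {F : List (List (Fin n))},
    List.Forall₂ (PieceOf H) es F → F.flatten.Nodup → ∀ e ∈ es, Proper e
  | [], _, _, _ => by simp
  | f :: es, _ :: F, List.Forall₂.cons h1 h2, hd => by
      rw [List.flatten_cons, List.nodup_append] at hd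
      intro e he
      rcases List.mem_cons.1 he with rfl | he
      · exact h1.ne hd.1
      · exact Proper.of_forall₂ h2 hd.2.1 e he

theorem exists_absorbing_piece_of_families {n : ℕ} {H : Finset (Finset (Fin n))}
    {F₁ F₂ : List (List (Fin n))} (h0 : F₂ ≠ []) (h1 : F₁.flatten.Nodup) (h2 : F₂.flatten.Nodup)
    (h12 : ∀ x ∈ F₂.flatten, x ∉ F₁.flatten) (hp : ∀ l ∈ F₂, ∃ e, PieceOf H e l)
    (hc : Connects H F₁ F₂.length) :
    ∃ B : List (Fin n), ∃ e, B.Nodup ∧ B.length ≤ F₂.flatten.length + F₁.flatten.length ∧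
      Proper e ∧ ∀ S : List (Fin n),
        (∀ v ∈ S, S.length ≤ F₂.countP fun l => decide (Absorber H v l)) →
        ∃ R, PieceOf H e R ∧ R.Perm (B ++ S) := by
  obtain ⟨es, hes, hpr⟩ := exists_proper_ends h2 hp
  cases es with
  | nil => cases hes; exact absurd rfl h0
  | cons e es =>
    have hlen := hes.length_eq
    obtain ⟨Cs, F', d, c1, c2, c3, c4⟩ := exists_chain es e F₁ 1
      (by rw [← hlen] at hc; exact hc) (hpr e (by simp))
      fun f hf => hpr f (List.mem_cons_of_mem _ hf)
    have hperm := c1.flatten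
    rw [List.flatten_append] at hperm
    have hd := List.nodup_append.1 (hperm.nodup h1)
    refine ⟨F₂.flatten ++ Cs.flatten, (e.1, d), ?_, ?_, ⟨(hpr e (by simp)).1, c2⟩, ?_⟩
    · refine List.nodup_append.2 ⟨h2, hd.1, fun x hx y hy hxy => ?_⟩
      subst hxy
      exact h12 x hx (hperm.symm.subset (List.mem_append_left _ hy))
    · have := hperm.length_eq
      rw [List.length_append] at this ⊢
      omega
    · intro S hS
      obtain ⟨Ps, p1, p2⟩ := exists_absorb S (e :: es) F₂ hes hS
      cases p1 with
      | @cons _ P _ Ps hP hPs =>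
        obtain ⟨R, r1, r2⟩ := c4 P Ps hP hPs
        refine ⟨R, r1, r2.trans ?_⟩
        rw [List.flatten_cons] at p2
        refine (p2.append_right _).trans ?_
        rw [List.append_assoc, List.append_assoc]
        exact List.perm_append_comm.append_left _

theorem exists_absorbing_piece {γ : ℝ} (hγ0 : 0 < γ) (hγ1 : γ ≤ 1) {ε : ℝ} (hε : 0 < ε) :
    ∃ κ : ℝ, 0 < κ ∧ ∃ n₀ : ℕ, ∀ {n : ℕ} {H : Finset (Finset (Fin n))}, n₀ ≤ n → PosaCond γ n H →
      ∃ B : List (Fin n), ∃ e, B.Nodup ∧ (B.length : ℝ) ≤ ε * n ∧ Proper e ∧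
        ∀ S : List (Fin n), (S.length : ℝ) ≤ κ * n → ∃ R, PieceOf H e R ∧ R.Perm (B ++ S) := by
  obtain ⟨L, β₁, hβ₁, hcon⟩ := exists_connectors hγ0 hγ1
  obtain ⟨K, β₂, hβ₂, habs⟩ := exists_absorber_family hγ0 hγ1
  obtain ⟨ρ₁, hρ₁, hρβ₁, hLρ, hLρ'⟩ : ∃ ρ : ℝ, 0 < ρ ∧ ρ ≤ β₁ ∧ L * ρ ≤ β₂ ∧ L * ρ ≤ ε / 2 := by
    have hb : 0 < min β₁ (min β₂ (ε / 2)) := by positivity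
    have hL : (0 : ℝ) ≤ L := by positivity
    have h1 : (L : ℝ) * (min β₁ (min β₂ (ε / 2)) / (L + 1)) ≤ min β₁ (min β₂ (ε / 2)) := by
      rw [mul_div_assoc', div_le_iff₀ (by positivity)]; nlinarith
    refine ⟨min β₁ (min β₂ (ε / 2)) / (L + 1), by positivity, ?_, h1.trans ?_, h1.trans ?_⟩
    · exact (div_le_self hb.le (by linarith)).trans (min_le_left _ _)
    · exact (min_le_right _ _).trans (min_le_left _ _)
    · exact (min_le_right _ _).trans (min_le_right _ _)
  obtain ⟨κ₁, hκ₁, n₁, hn₁⟩ := hcon ρ₁ hρ₁ hρβ₁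
  obtain ⟨ρ₂, hρ₂, hρβ₂, hρκ, hKρ⟩ : ∃ ρ : ℝ, 0 < ρ ∧ ρ ≤ β₂ ∧ ρ ≤ κ₁ ∧ K * ρ ≤ ε / 2 := by
    have hb : 0 < min β₂ (min κ₁ (ε / 2)) := by positivity
    have hK : (0 : ℝ) ≤ K := by positivity
    have h1 : (K : ℝ) * (min β₂ (min κ₁ (ε / 2)) / (K + 1)) ≤ min β₂ (min κ₁ (ε / 2)) := by
      rw [mul_div_assoc', div_le_iff₀ (by positivity)]; nlinarith
    have h2 := div_le_self hb.le (by linarith : (1 : ℝ) ≤ K + 1)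
    refine ⟨min β₂ (min κ₁ (ε / 2)) / (K + 1), by positivity, h2.trans (min_le_left _ _),
      h2.trans ?_, h1.trans ?_⟩
    · exact (min_le_right _ _).trans (min_le_left _ _)
    · exact (min_le_right _ _).trans (min_le_right _ _)
  obtain ⟨κ₂, hκ₂, n₂, hn₂⟩ := habs ρ₂ hρ₂ hρβ₂
  obtain ⟨N, hN⟩ := exists_nat_ge (1 / κ₂)
  rw [div_le_iff₀ hκ₂] at hN
  refine ⟨κ₂, hκ₂, n₁ + n₂ + N + 1, fun {n H} hn hH => ?_⟩
  have hn0 : (0 : ℝ) ≤ n := by positivity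
  have h1n : 1 ≤ κ₂ * n := by
    have : (N : ℝ) ≤ n := by exact_mod_cast (by omega : N ≤ n)
    nlinarith
  obtain ⟨F₁, a1, a2, -, a4⟩ := hn₁ (by omega : n₁ ≤ n) hH ∅ (by simp; positivity)
  obtain ⟨F₂, b1, b2, b3, b4, b5, b6⟩ := hn₂ (by omega : n₂ ≤ n) hH F₁.flatten.toFinset (by
    rw [List.toFinset_card_of_nodup a2]
    refine a1.trans ?_
    rw [← mul_assoc]
    gcongr)
  have hne : F₂ ≠ [] := by
    rintro rfl
    have := b6 ⟨0, by omega⟩ 1 (by simpa using h1n)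
    simp at this
  obtain ⟨B, e, c1, c2, c3, c4⟩ := exists_absorbing_piece_of_families hne a2 b3
    (fun x hx h => b4 x hx (List.mem_toFinset.2 h)) b5
    (a4 _ (b1.trans (by gcongr)))
  refine ⟨B, e, c1, ?_, c3, fun S hS => c4 S fun v _ => b6 v _ hS⟩
  have h3 : (B.length : ℝ) ≤ F₂.flatten.length + F₁.flatten.length := by exact_mod_cast c2
  have h4 : (L : ℝ) * (ρ₁ * n) ≤ ε / 2 * n := by rw [← mul_assoc]; gcongr
  have h5 : (K : ℝ) * (ρ₂ * n) ≤ ε / 2 * n := by rw [← mul_assoc]; gcongr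
  linarith

theorem PosaCond.exists_tightHamiltonCycle {γ : ℝ} (hγ0 : 0 < γ) (hγ1 : γ ≤ 1) :
    ∃ n₀ : ℕ, ∀ {n : ℕ} {H : Finset (Finset (Fin n))}, n₀ ≤ n → PosaCond γ n H →
      HasTightHamiltonCycle H := by
  obtain ⟨L, β, hβ, hcon⟩ := exists_connectors hγ0 hγ1
  obtain ⟨κ, hκ, n₁, hn₁⟩ := exists_absorbing_piece hγ0 hγ1 (ε := min β (γ / 32)) (by positivity)
  obtain ⟨ρ, hρ, hρβ, hLγ, hLκ⟩ : ∃ ρ : ℝ, 0 < ρ ∧ ρ ≤ β ∧ L * ρ ≤ γ / 32 ∧ L * ρ ≤ κ / 2 := by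
    have hb : 0 < min β (min (γ / 32) (κ / 2)) := by positivity
    have hL : (0 : ℝ) ≤ L := by positivity
    have h1 : (L : ℝ) * (min β (min (γ / 32) (κ / 2)) / (L + 1)) ≤
        min β (min (γ / 32) (κ / 2)) := by
      rw [mul_div_assoc', div_le_iff₀ (by positivity)]; nlinarith
    refine ⟨min β (min (γ / 32) (κ / 2)) / (L + 1), by positivity, ?_, h1.trans ?_, h1.trans ?_⟩
    · exact (div_le_self hb.le (by linarith)).trans (min_le_left _ _)
    · exact (min_le_right _ _).trans (min_le_left _ _)
    · exact (min_le_right _ _).trans (min_le_right _ _)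
  obtain ⟨κ', hκ', n₂, hn₂⟩ := hcon ρ hρ hρβ
  obtain ⟨M, hM⟩ := exists_nat_ge (2 / κ')
  rw [div_le_iff₀ hκ'] at hM
  obtain ⟨N, hN⟩ := exists_tiling hγ0 hγ1 (m := M + 2) (by omega)
  obtain ⟨N', hN'⟩ := exists_nat_ge (2 * N / κ)
  rw [div_le_iff₀ hκ] at hN'
  refine ⟨n₁ + n₂ + M + N + N' + 1, fun {n H} hn hH => ?_⟩
  have hn0 : (0 : ℝ) ≤ n := by positivity
  have hMn : (M : ℝ) ≤ n := by exact_mod_cast (by omega : M ≤ n)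
  have hN'n : (N' : ℝ) ≤ n := by exact_mod_cast (by omega : N' ≤ n)
  obtain ⟨B, e, b1, b2, b3, b4⟩ := hn₁ (by omega : n₁ ≤ n) hH
  have hBc := List.toFinset_card_of_nodup b1
  obtain ⟨F, f1, f2, f3, f4⟩ := hn₂ (by omega : n₂ ≤ n) hH B.toFinset (by
    rw [hBc]
    refine b2.trans ?_
    gcongr
    exact min_le_left _ _)
  have hF1 : (F.flatten.length : ℝ) ≤ γ / 32 * n := by
    refine f1.trans ?_; rw [← mul_assoc]; gcongr
  have hF2 : (F.flatten.length : ℝ) ≤ κ / 2 * n := by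
    refine f1.trans ?_; rw [← mul_assoc]; gcongr
  obtain ⟨S, s1, s2, s3⟩ := hN (by omega : N ≤ n) hH (B.toFinset ∪ F.flatten.toFinset) (by
    have h1 : ((B.toFinset ∪ F.flatten.toFinset).card : ℝ) ≤ B.length + F.flatten.length := by
      exact_mod_cast (card_union_le _ _).trans
        (Nat.add_le_add hBc.le (List.toFinset_card_le _))
    have h2 : min β (γ / 32) * n ≤ γ / 32 * n := by gcongr; exact min_le_right _ _
    linarith)
  obtain ⟨es, Ps, t1, t2, t3, t4⟩ := s2.exists_pieces hH.three (by omega)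
  have hlen : ((es.length + 1 : ℕ) : ℝ) ≤ κ' * n := by
    have h1 : es.length * (3 * (M + 2)) ≤ n := by
      rw [t1.length_eq, t4]
      exact (card_le_univ S).trans (by simp)
    have h2 : es.length * M ≤ n := by nlinarith
    have h3 : (es.length : ℝ) * M ≤ n := by exact_mod_cast h2
    push_cast
    rcases Nat.eq_zero_or_pos es.length with h | h
    · rw [h]; push_cast; nlinarith
    · have h4 : (1 : ℝ) ≤ es.length := by exact_mod_cast h
      have h5 : 2 * (es.length : ℝ) ≤ (M * κ') * es.length := by gcongr
      nlinarith
  obtain ⟨Cs, F', d, c1, c2, c3, c4⟩ := exists_chain es e F 1 (f4 _ hlen) b3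
    (Proper.of_forall₂ t1 t2)
  obtain ⟨C, hC, hCJ, -⟩ := c3.exists_mem (t := 0) (e := d) (f := e.1) c2 b3.1
  have hperm : F.flatten.Perm (Cs.flatten ++ (C ++ (F'.erase C).flatten)) := by
    refine c1.flatten.trans ?_
    rw [List.flatten_append]
    exact (List.perm_cons_erase hC).flatten.append_left _
  have hBF : ∀ x ∈ F.flatten, x ∉ B := fun x hx h => f3 x hx (List.mem_toFinset.2 h)
  have hS : ∀ x ∈ S, x ∉ B ∧ x ∉ F.flatten := fun x hx => by
    have := disjoint_left.1 s1 hx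
    simpa only [mem_union, List.mem_toFinset, not_or] using this
  have hCsC : (Cs.flatten ++ C).Nodup := by
    have := hperm.nodup f2
    rw [← List.append_assoc] at this
    exact (List.nodup_append.1 this).1
  have hmem : ∀ x ∈ Cs.flatten ++ C, x ∈ F.flatten := fun x hx => by
    refine hperm.symm.subset ?_
    rw [← List.append_assoc]
    exact List.mem_append_left _ hx
  have hU : (B ++ (Ps.flatten ++ (Cs.flatten ++ C))).Nodup := by
    refine List.nodup_append.2 ⟨b1, List.nodup_append.2 ⟨t2, hCsC, ?_⟩, ?_⟩
    · rintro x hx _ hy rfl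
      exact (hS x ((t3 x).1 hx)).2 (hmem x hy)
    · rintro x hx _ hy rfl
      rcases List.mem_append.1 hy with hy | hy
      · exact (hS x ((t3 x).1 hy)).1 hx
      · exact hBF x (hmem x hy) hx
  set U := B ++ (Ps.flatten ++ (Cs.flatten ++ C)) with hUdef
  obtain ⟨R₁, r1, r2⟩ := b4 (univ \ U.toFinset).toList (by
    rw [length_toList]
    have h1 : univ \ U.toFinset ⊆
        F.flatten.toFinset ∪ univ \ ((B.toFinset ∪ F.flatten.toFinset) ∪ S) := by
      intro x hx
      simp only [hUdef, mem_sdiff, mem_univ, true_and, mem_union, List.mem_toFinset,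
        List.mem_append, t3, not_or] at hx ⊢
      tauto
    have h2 : ((univ \ U.toFinset).card : ℝ) ≤ F.flatten.length + N := by
      exact_mod_cast (card_le_card h1).trans ((card_union_le _ _).trans
        (Nat.add_le_add (List.toFinset_card_le _) s3))
    have h3 : 2 * (N : ℝ) ≤ κ * n := by nlinarith
    linarith)
  obtain ⟨R, q1, q2⟩ := c4 R₁ Ps r1 t1
  have hRU : (R ++ C).Perm (U ++ (univ \ U.toFinset).toList) := by
    have h1 := (q2.trans ((r2.append_right _).append_right _)).append_right C
    refine h1.trans ?_
    rw [← Multiset.coe_eq_coe, hUdef]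
    simp only [← Multiset.coe_add]
    ac_rfl
  refine q1.hasTightHamiltonCycle hCJ (hRU.symm.nodup ?_) fun x => hRU.symm.subset ?_
  · refine List.nodup_append.2 ⟨hU, nodup_toList _, ?_⟩
    rintro x hx _ hy rfl
    rw [mem_toList, mem_sdiff] at hy
    exact hy.2 (List.mem_toFinset.2 hx)
  · by_cases hx : x ∈ U
    · exact List.mem_append_left _ hx
    · refine List.mem_append_right _ ?_
      rw [mem_toList, mem_sdiff, List.mem_toFinset]
      exact ⟨mem_univ _, hx⟩

/-- Schülke: for all `γ > 0` there exists `n₀` such that for `n ≥ n₀`, any `3`-graph `H`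
on vertex set `[n]` (vertex `i : Fin n` carrying label `i+1`) with
`d(i,j) ≥ min((i+j)/2, n/2) + γn` for all pairs of distinct vertices `i, j`
contains a tight Hamilton cycle. -/
theorem schulke_tight_hamilton (γ : ℝ) (hγ : 0 < γ) :
    ∃ n₀ : ℕ, ∀ n : ℕ, n₀ ≤ n →
      ∀ H : Finset (Finset (Fin n)), Is3Graph n H →
      (∀ i j : Fin n, i ≠ j →
        min ((((i : ℕ) + 1 : ℝ) + ((j : ℕ) + 1)) / 2) ((n : ℝ) / 2) + γ * n
          ≤ (pairDeg H i j : ℝ)) →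
      HasTightHamiltonCycle H := by
  obtain ⟨n₀, h⟩ := PosaCond.exists_tightHamiltonCycle (lt_min hγ one_pos) (min_le_right γ 1)
  refine ⟨n₀, fun n hn H h3 hd => h hn ⟨h3, fun i j hij => ?_⟩⟩
  rw [card_nbr h3 hij]
  refine le_trans ?_ (hd i j hij)
  gcongr
  · linarith
  · linarith
  · exact min_le_left γ 1
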